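/- Let q be an odd prime power, d ≥ 2, and let Q be a non-degenerate quadratic form on F_q^d, with associated distance φ(x,y) = Q(x−y). Fix t ∈ F_q \ {0}, let E ⊆ F_q^d, and for n ≥ 3 let C_n denote the number of n-tuples (x_1, …, x_n) ∈ E^n with φ(x_i, x_{i+1}) = t for 1 ≤ i ≤ n−1 and φ(x_n, x_1) = t. Let γ = −1 if d = 2 and γ = −(d−2)/2 if d ≥ 3. Suppose n ≥ 6 and 12 q^γ + 8 q^{d+2}/|E|² + (24 + 12⌊n/2⌋) q^{(d+1)/2}/|E| ≤ 1. Then | C_n − |E|^n/q^n | ≤ (|E|^n/q^n) ( 12 q^γ + 8 q^{d+1}/|E|² + (24 + 12⌊n/2⌋) q^{(d+1)/2}/|E| ). -/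

import Mathlib

open Polynomial in
theorem wk_sqfree_aux {L : Type*} [Field L] (h r s : L[X]) (c : L) (hc : c ≠ 0)
    (hs : Squarefree h) (hu : ¬ IsUnit h) (he : r ^ 2 * h = C c * s ^ 2) : r = 0 ∧ s = 0 := by
  have h0 : h ≠ 0 := hs.ne_zero
  by_cases hr : r = 0
  · subst hr
    have : C c * s ^ 2 = 0 := by rw [← he]; simp
    have h2 := mul_eq_zero.1 this
    simp [hc] at h2
    exact ⟨rfl, h2⟩
  · exfalso
    have hs0 : s ≠ 0 := by
      rintro rfl
      have : r ^ 2 * h ≠ 0 := mul_ne_zero (pow_ne_zero _ hr) h0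
      apply this; rw [he]; simp
    obtain ⟨π, hπ, hd⟩ := WfDvdMonoid.exists_irreducible_factor hu h0
    have hp : Prime π := hπ.prime
    have hcc : (C c : L[X]) ≠ 0 := by simpa using hc
    have e1 : emultiplicity π (r ^ 2 * h) = emultiplicity π (C c * s ^ 2) := by rw [he]
    rw [emultiplicity_mul hp, emultiplicity_mul hp, emultiplicity_pow hp, emultiplicity_pow hp] at e1
    have hc1 : emultiplicity π (C c) = 0 := by
      rw [emultiplicity_eq_zero]
      intro hdv
      exact hp.not_isUnit (isUnit_of_dvd_unit hdv (isUnit_C.2 (isUnit_iff_ne_zero.2 hc)))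
    have hh1 : emultiplicity π h = 1 := by
      apply le_antisymm
      · exact (squarefree_iff_emultiplicity_le_one h).1 hs π |>.resolve_right hp.not_isUnit
      · have := (pow_dvd_iff_le_emultiplicity (a := π) (b := h) (k := 1)).1 (by simpa using hd)
        simpa using this
    have fr : FiniteMultiplicity π r := FiniteMultiplicity.of_prime_left hp hr
    have fs : FiniteMultiplicity π s := FiniteMultiplicity.of_prime_left hp hs0
    rw [hc1, hh1, fr.emultiplicity_eq_multiplicity, fs.emultiplicity_eq_multiplicity] at e1
    have : 2 * multiplicity π r + 1 = 0 + 2 * multiplicity π s := by exact_mod_cast e1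
    omega

open Polynomial in
theorem wk_nonvan {L : Type*} [Field L] (p : ℕ) [Fact p.Prime] [CharP L p] (k M u m : ℕ)
    (hM : M = p ^ k) (h Φ : L[X]) (hΦ : Φ ^ 2 * h = h ^ M) (h0 : h.coeff 0 ≠ 0)
    (hs : Squarefree h) (hu : ¬ IsUnit h) (hm : h.natDegree ≤ m) (hum : 2 * u + m ≤ M) :
    ∀ (J : ℕ) (r s : ℕ → L[X]), (∀ j, (r j).degree < u) → (∀ j, (s j).degree < u) →
      (∑ j ∈ Finset.range J, (r j + s j * Φ) * X ^ (j * M)) = 0 →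
      ∀ j < J, r j = 0 ∧ s j = 0 := by
  intro J
  induction J with
  | zero => intro r s _ _ _ j hj; omega
  | succ J ih =>
    intro r s hr hs' hz
    rw [Finset.sum_range_succ'] at hz
    have hz2 : (∑ j ∈ Finset.range J, (r (j+1) + s (j+1) * Φ) * X ^ (j * M)) * X ^ M
        + (r 0 + s 0 * Φ) = 0 := by
      rw [← hz, Finset.sum_mul]
      congr 1
      · apply Finset.sum_congr rfl; intro j _; ring
      · simp
    have hdv : X ^ M ∣ r 0 + s 0 * Φ := by
      rw [eq_neg_of_add_eq_zero_right hz2]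
      exact (Dvd.intro_left _ rfl).neg_right
    obtain ⟨g, hg⟩ : X ∣ h - C (h.coeff 0) := by
      rw [X_dvd_iff]; simp
    have hhM : h ^ M = C (h.coeff 0 ^ M) + X ^ M * g ^ M := by
      have : h = C (h.coeff 0) + X * g := by rw [← hg]; ring
      conv_lhs => rw [this]
      rw [hM, add_pow_char_pow, mul_pow, C_pow]
    have hdv2 : X ^ M ∣ (r 0) ^ 2 * h - C (h.coeff 0 ^ M) * (s 0) ^ 2 := by
      have e : (r 0) ^ 2 * h - C (h.coeff 0 ^ M) * (s 0) ^ 2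
        = (r 0 + s 0 * Φ) * ((r 0 - s 0 * Φ) * h) + X ^ M * (g ^ M * (s 0) ^ 2) := by
        have : C (h.coeff 0 ^ M) = Φ ^ 2 * h - X ^ M * g ^ M := by rw [hΦ, hhM]; ring
        rw [this]; ring
      rw [e]
      exact dvd_add (hdv.mul_right _) (Dvd.intro _ rfl)
    have hdr : (r 0).degree < u := hr 0
    have hds : (s 0).degree < u := hs' 0
    have hle : ∀ f : L[X], f.degree < u → f = 0 ∨ f.natDegree + 1 ≤ u := by
      intro f hf
      by_cases hf0 : f = 0
      · left; exact hf0
      · right; exact (natDegree_lt_iff_degree_lt hf0).2 hf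
    have hdeg0 : (r 0) ^ 2 * h - C (h.coeff 0 ^ M) * (s 0) ^ 2 = 0 := by
      by_cases hu0 : u = 0
      · subst hu0
        have a1 : r 0 = 0 := by simpa using hdr
        have a2 : s 0 = 0 := by simpa using hds
        simp [a1, a2]
      · apply eq_zero_of_dvd_of_natDegree_lt hdv2
        rw [natDegree_X_pow]
        have b1 : ((r 0) ^ 2 * h).natDegree ≤ 2 * (r 0).natDegree + m := by
          refine natDegree_mul_le.trans ?_
          have := natDegree_pow_le (p := r 0) (n := 2)
          omega
        have b2 : (C (h.coeff 0 ^ M) * (s 0) ^ 2).natDegree ≤ 2 * (s 0).natDegree := by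
          refine (natDegree_C_mul_le _ _).trans natDegree_pow_le
        have b3 : (r 0).natDegree + 1 ≤ u := by
          rcases hle _ hdr with h | h
          · rw [h]; simp; omega
          · exact h
        have b4 : (s 0).natDegree + 1 ≤ u := by
          rcases hle _ hds with h | h
          · rw [h]; simp; omega
          · exact h
        have := natDegree_sub_le ((r 0) ^ 2 * h) (C (h.coeff 0 ^ M) * (s 0) ^ 2)
        omega
    obtain ⟨z1, z2⟩ := wk_sqfree_aux h (r 0) (s 0) _ (pow_ne_zero M h0) hs hu (sub_eq_zero.1 hdeg0)
    have hz3 : (∑ j ∈ Finset.range J, (r (j+1) + s (j+1) * Φ) * X ^ (j * M)) = 0 := by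
      rw [z1, z2] at hz2
      simp only [zero_mul, add_zero] at hz2
      exact (mul_eq_zero.1 hz2).resolve_right (pow_ne_zero _ X_ne_zero)
    have := ih (fun j => r (j+1)) (fun j => s (j+1)) (fun j => hr _) (fun j => hs' _) hz3
    intro j hj
    cases j with
    | zero => exact ⟨z1, z2⟩
    | succ j => exact this j (by omega)


open Polynomial in
/-- The linear map whose kernel yields the auxiliary polynomial. -/
noncomputable def wkT {L : Type*} [Field L] (u J M : ℕ) (Φ : L[X]) :
    ((Fin J → degreeLT L u) × (Fin J → degreeLT L u)) →ₗ[L] L[X] where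
  toFun v := ∑ j : Fin J, (expand L M (v.1 j : L[X]) * Φ + expand L M (v.2 j : L[X])) * X ^ (j : ℕ)
  map_add' v w := by
    rw [← Finset.sum_add_distrib]
    apply Finset.sum_congr rfl
    intro j _
    simp only [Prod.fst_add, Prod.snd_add, Pi.add_apply, Submodule.coe_add, map_add]
    ring
  map_smul' c v := by
    rw [RingHom.id_apply, Finset.smul_sum]
    apply Finset.sum_congr rfl
    intro j _
    simp only [Prod.smul_fst, Prod.smul_snd, Pi.smul_apply, Submodule.coe_smul, smul_eq_C_mul, map_mul, expand_C]
    ring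

open Polynomial in
theorem wk_stepanov {L : Type*} [Field L] [Fintype L] (p : ℕ) [Fact p.Prime] [CharP L p]
    (k M N q : ℕ) (hM : M = p ^ k) (hN : M = 2 * N + 1) (hq : 1 ≤ q) (hqN : 2 * q + 3 ≤ N)
    (hcard : Fintype.card L = M ^ 2)
    (h : L[X]) (h0 : h.coeff 0 ≠ 0) (hs : Squarefree h) (hu : ¬ IsUnit h)
    (hm : h.natDegree ≤ 2 * q) (S : Finset L)
    (hS : ∀ y ∈ S, (h.eval y) ^ (2 * N * (N + 1)) = 1) :
    2 * S.card ≤ M ^ 2 + 6 * q * M := by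
  classical
  set Φ : L[X] := h ^ N with hΦdef
  have hΦ : Φ ^ 2 * h = h ^ M := by rw [hΦdef, hN]; ring
  have hMpos : 0 < M := by omega
  set u := N - q with hudef
  set J := N + 1 + 2 * q with hJdef
  set D := u * M + J + 2 * q * N with hDdef
  have hΦdeg : Φ.natDegree ≤ 2 * q * N := by
    refine natDegree_pow_le.trans ?_
    nlinarith
  have hupos : 1 ≤ u := by omega
  have hnd : ∀ v : degreeLT L u, (v : L[X]).natDegree + 1 ≤ u := by
    intro v
    by_cases hv : (v : L[X]) = 0
    · rw [hv]; simpa using hupos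
    · exact (natDegree_lt_iff_degree_lt hv).2 (mem_degreeLT.1 v.2)
  have hTD : ∀ v, wkT u J M Φ v ∈ degreeLT L D := by
    intro v
    change (∑ j : Fin J, (expand L M (v.1 j : L[X]) * Φ + expand L M (v.2 j : L[X])) * X ^ (j : ℕ)) ∈ _
    apply Submodule.sum_mem
    intro j _
    rw [mem_degreeLT]
    have hj := j.2
    refine (degree_le_natDegree).trans_lt ?_
    rw [Nat.cast_lt]
    have e1 : (expand L M (v.1 j : L[X]) * Φ).natDegree ≤ (u - 1) * M + 2 * q * N := by
      refine natDegree_mul_le.trans ?_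
      rw [natDegree_expand]
      have := hnd (v.1 j)
      have : (v.1 j : L[X]).natDegree * M ≤ (u - 1) * M := Nat.mul_le_mul_right _ (by omega)
      omega
    have e2 : (expand L M (v.2 j : L[X])).natDegree ≤ (u - 1) * M + 2 * q * N := by
      rw [natDegree_expand]
      have := hnd (v.2 j)
      have : (v.2 j : L[X]).natDegree * M ≤ (u - 1) * M := Nat.mul_le_mul_right _ (by omega)
      omega
    have e3 := natDegree_add_le_of_degree_le e1 e2
    have e4 : (u - 1) * M ≤ u * M := Nat.mul_le_mul_right _ (by omega)
    refine natDegree_mul_le.trans_lt ?_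
    rw [natDegree_X_pow]
    omega
  have hker : LinearMap.ker ((wkT u J M Φ).codRestrict (degreeLT L D) hTD) ≠ ⊥ := by
    have : ∀ n, Module.Finite L (degreeLT L n) := fun n =>
      Module.Finite.equiv (degreeLTEquiv L n).symm
    have hfr : ∀ n, Module.finrank L (degreeLT L n) = n := fun n => by
      rw [(degreeLTEquiv L n).finrank_eq]; simp
    apply LinearMap.ker_ne_bot_of_finrank_lt
    rw [Module.finrank_prod, Module.finrank_pi_fintype, hfr]
    simp only [hfr, Finset.sum_const, Finset.card_univ, Fintype.card_fin, smul_eq_mul]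
    have hNu : N = u + q := by omega
    rw [hDdef, hJdef, hN, hNu]
    have : q + 3 ≤ u := by omega
    nlinarith
  obtain ⟨v, hv, hv0⟩ := Submodule.exists_mem_ne_zero_of_ne_bot hker
  have hvT : wkT u J M Φ v = 0 := by
    have := congrArg Subtype.val (LinearMap.mem_ker.1 hv)
    simpa using this
  -- Frobenius
  set fr := iterateFrobenius L p k with hfr
  have hfra : ∀ x : L, fr x = x ^ M := by intro x; rw [hfr, iterateFrobenius_def, hM]
  have hQ : ∀ x : L, x ^ (M * M) = x := by
    intro x; rw [← pow_two, ← hcard]; exact FiniteField.pow_card x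
  have hfr2 : ∀ f : L[X], (f.map fr) ^ M = expand L M f := by
    intro f
    rw [hM, ← map_iterateFrobenius_expand]
    ext n
    simp only [coeff_map, coeff_expand (pow_pos (Fact.out : p.Prime).pos k)]
    split_ifs
    · rw [hfra, hfra, ← pow_mul, hQ]
    · simp
  let r : ℕ → L[X] := fun j => if hj : j < J then ((v.1 ⟨j, hj⟩ : L[X])).map fr else 0
  let s : ℕ → L[X] := fun j => if hj : j < J then ((v.2 ⟨j, hj⟩ : L[X])).map fr else 0
  have hrdeg : ∀ j, (r j).degree < u := by
    intro j
    simp only [r]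
    split_ifs with hj
    · rw [degree_map]; exact mem_degreeLT.1 (v.1 ⟨j, hj⟩).2
    · rw [degree_zero]; exact WithBot.bot_lt_coe _
  have hsdeg : ∀ j, (s j).degree < u := by
    intro j
    simp only [s]
    split_ifs with hj
    · rw [degree_map]; exact mem_degreeLT.1 (v.2 ⟨j, hj⟩).2
    · rw [degree_zero]; exact WithBot.bot_lt_coe _
  set G : L[X] := ∑ j ∈ Finset.range J, (r j + s j * Φ) * X ^ (j * M) with hG
  have hG0 : G ≠ 0 := by
    intro hz
    have := wk_nonvan p k M u (2 * q) hM h Φ hΦ h0 hs hu hm (by omega) J r s hrdeg hsdeg hz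
    apply hv0
    ext j : 2
    · have h1 := (this j j.2).1
      simp only [r, j.2, dif_pos] at h1
      rw [Polynomial.map_eq_zero] at h1
      simpa using h1
    · have h1 := (this j j.2).2
      simp only [s, j.2, dif_pos] at h1
      rw [Polynomial.map_eq_zero] at h1
      simpa using h1
  have hGdeg : G.natDegree ≤ u + (J - 1) * M + 2 * q * N := by
    apply natDegree_sum_le_of_forall_le
    intro j hj
    rw [Finset.mem_range] at hj
    have hnd' : ∀ f : L[X], f.degree < u → f.natDegree ≤ u := fun f hf =>
      natDegree_le_of_degree_le hf.le
    have e1 := hnd' _ (hrdeg j)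
    have e2 := hnd' _ (hsdeg j)
    have e3 : (r j).natDegree ≤ u + 2 * q * N := by omega
    have e4 : (s j * Φ).natDegree ≤ u + 2 * q * N := natDegree_mul_le.trans (by omega)
    have e5 := natDegree_add_le_of_degree_le e3 e4
    refine natDegree_mul_le.trans ?_
    rw [natDegree_X_pow]
    have : j * M ≤ (J - 1) * M := Nat.mul_le_mul_right _ (by omega)
    omega
  have hroot : ∀ y ∈ S, G.eval y = 0 := by
    intro y hy
    have hy1 := hS y hy
    set a := Φ.eval y with ha
    have ha1 : a ^ M * a = 1 := by
      rw [← pow_succ, ha, hΦdef, eval_pow, ← pow_mul, ← hy1, hN]; ring_nf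
    have ha0 : a ≠ 0 := by rintro h; rw [h] at ha1; simp at ha1
    have hp : (G.eval y) ^ M * a = 0 := by
      have e1 : G ^ M = ∑ j ∈ Finset.range J, ((r j) ^ M + (s j) ^ M * Φ ^ M) * X ^ (j * (M * M)) := by
        rw [hG, hM, sum_pow_char_pow]
        apply Finset.sum_congr rfl
        intro j _
        rw [mul_pow, add_pow_char_pow, mul_pow, ← pow_mul (X : L[X]), mul_assoc j]
      rw [← eval_pow, e1, eval_finsetSum, Finset.sum_mul, ← Fin.sum_univ_eq_sum_range (fun j => (eval y (((r j) ^ M + (s j) ^ M * Φ ^ M) * X ^ (j * (M * M)))) * a) J]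
      have e2 := congrArg (eval y) hvT
      rw [eval_zero] at e2
      rw [← e2]
      change _ = eval y (∑ j : Fin J, (expand L M (v.1 j : L[X]) * Φ + expand L M (v.2 j : L[X])) * X ^ (j : ℕ))
      rw [eval_finsetSum]
      apply Finset.sum_congr rfl
      intro j _
      have r1 : (r j) ^ M = expand L M (v.1 j : L[X]) := by
        simp only [r, j.2, dif_pos]; exact hfr2 _
      have s1 : (s j) ^ M = expand L M (v.2 j : L[X]) := by
        simp only [s, j.2, dif_pos]; exact hfr2 _
      rw [r1, s1]
      simp only [eval_mul, eval_add, eval_pow, eval_X]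
      rw [← ha, mul_comm (j : ℕ) (M * M), pow_mul, hQ]
      linear_combination (eval y ((expand L M) (v.2 j : L[X])) * y ^ (j : ℕ)) * ha1
    exact pow_eq_zero_iff hMpos.ne' |>.1 ((mul_eq_zero.1 hp).resolve_right ha0)
  have hcardS : S.card ≤ G.natDegree := by
    refine le_trans (Finset.card_le_card ?_) ((Multiset.toFinset_card_le G.roots).trans G.card_roots')
    intro y hy
    rw [Multiset.mem_toFinset, mem_roots hG0]
    exact hroot y hy
  have hNu : N = u + q := by omega
  have hJ1 : J - 1 = N + 2 * q := by omega
  rw [hJ1] at hGdeg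
  have : S.card ≤ u + (N + 2 * q) * M + 2 * q * N := hcardS.trans hGdeg
  rw [hN] at this ⊢
  nlinarith


section
variable {F L : Type*} [Field F] [Fintype F] [Field L] [Fintype L] [Algebra F L]

theorem wk_trace_pow (y : L) : Algebra.trace F L (y ^ Fintype.card F) = Algebra.trace F L y := by
  have := Algebra.trace_eq_of_algEquiv (FiniteField.frobeniusAlgEquivOfAlgebraic F L) y
  simpa [FiniteField.coe_frobeniusAlgEquivOfAlgebraic] using this

open Polynomial in
theorem wk_hilbert (z : L) (hz : Algebra.trace F L z = 0) :
    ∃ y : L, y ^ Fintype.card F - y = z := by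
  let φ : L →ₗ[F] L := (FiniteField.frobeniusAlgHom F L).toLinearMap - LinearMap.id
  have hφ : ∀ y, φ y = y ^ Fintype.card F - y := fun y => by
    simp [φ]
  have hle : LinearMap.range φ ≤ LinearMap.ker (Algebra.trace F L) := by
    rintro _ ⟨y, rfl⟩
    rw [LinearMap.mem_ker, hφ, map_sub, wk_trace_pow, sub_self]
  have hker : LinearMap.ker φ ≤ Submodule.span F {(1 : L)} := by
    intro y hy
    rw [LinearMap.mem_ker, hφ, sub_eq_zero] at hy
    rw [Submodule.mem_span_singleton]
    have hmem : y ∈ Set.range (algebraMap F L) := by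
      rw [IsGalois.mem_range_algebraMap_iff_fixed]
      intro g
      obtain ⟨p, hpc, f, hp, hqf⟩ := FiniteField.card' F
      have : Fact p.Prime := ⟨hp⟩
      obtain ⟨n, hn⟩ := FiniteField.exists_forall_apply_eq_pow F p L g
      rw [hn]
      have : ∀ n : ℕ, y ^ (Nat.card F ^ n) = y := by
        intro n
        induction n with
        | zero => simp
        | succ n ih => rw [pow_succ, pow_mul, ih, Nat.card_eq_fintype_card, hy]
      exact this _
    obtain ⟨a, ha⟩ := hmem
    exact ⟨a, by rw [← ha, Algebra.smul_def, mul_one]⟩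
  have h1 : Module.finrank F (LinearMap.ker φ) ≤ 1 :=
    (Submodule.finrank_mono hker).trans (finrank_span_singleton (K := F) (one_ne_zero (α := L))).le
  have h2 := LinearMap.finrank_range_add_finrank_ker φ
  have h3 := LinearMap.finrank_range_add_finrank_ker (Algebra.trace F L)
  have h4 : LinearMap.range (Algebra.trace F L) = ⊤ :=
    LinearMap.range_eq_top.2 (Algebra.trace_surjective F L)
  rw [h4, finrank_top, Module.finrank_self] at h3
  have h5 := Submodule.eq_of_le_of_finrank_le hle (by omega)
  have h6 : z ∈ LinearMap.range φ := by rw [h5]; exact hz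
  obtain ⟨y, hy⟩ := h6
  exact ⟨y, by rw [← hφ, hy]⟩

theorem wk_exists_e (hodd : Odd (Fintype.card F)) (hn : 2 ≤ Module.finrank F L) (c : F) (δ : L) :
    ∃ e : L, Algebra.trace F L e = c ∧ e ^ 2 ≠ δ := by
  obtain ⟨e0, he0⟩ := Algebra.trace_surjective F L c
  by_contra! hcon
  have h3 := LinearMap.finrank_range_add_finrank_ker (Algebra.trace F L)
  have h4 : LinearMap.range (Algebra.trace F L) = ⊤ :=
    LinearMap.range_eq_top.2 (Algebra.trace_surjective F L)
  rw [h4, finrank_top, Module.finrank_self] at h3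
  have hne : LinearMap.ker (Algebra.trace F L) ≠ ⊥ := by
    intro hb; rw [hb, finrank_bot] at h3; omega
  obtain ⟨z, hz, hz0⟩ := Submodule.exists_mem_ne_zero_of_ne_bot hne
  rw [LinearMap.mem_ker] at hz
  have h20 : (2 : L) ≠ 0 := by
    have : (2 : F) ≠ 0 := by
      apply Ring.two_ne_zero
      intro h
      have := FiniteField.even_card_of_char_two h
      rcases hodd with ⟨k, hk⟩
      omega
    intro h
    apply this
    apply (algebraMap F L).injective
    rw [map_ofNat, map_zero, h]
  have a0 := hcon e0 he0
  have a1 := hcon (e0 + z) (by rw [map_add, he0, hz, add_zero])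
  have a2 := hcon (e0 + z + z) (by rw [map_add, map_add, he0, hz, add_zero, add_zero])
  have : 2 * (z * z) = 0 := by linear_combination a2 - 2 * a1 + a0
  simp [h20, hz0] at this

open Polynomial in
theorem wk_count (hodd : Odd (Fintype.card F)) (k : ℕ) (hk : 3 ≤ k)
    (hn : Module.finrank F L = 2 * k) (a b c : F) (ha : a ≠ 0) (hb : b ≠ 0) (A : Finset L)
    (hA : ∀ x ∈ A, x ≠ 0 ∧ Algebra.trace F L (algebraMap F L a * x + algebraMap F L b * x⁻¹) = c) :
    Fintype.card F * A.card ≤ (Fintype.card F) ^ (2 * k) + 10 * Fintype.card F * (Fintype.card F) ^ k := by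
  classical
  set q := Fintype.card F with hq
  obtain ⟨p, hpc, f, hp, hqf⟩ := FiniteField.card' F
  have : Fact p.Prime := ⟨hp⟩
  have : CharP L p := charP_of_injective_algebraMap (algebraMap F L).injective p
  have hq3 : 3 ≤ q := by
    have h1 : 1 < q := Fintype.one_lt_card
    rcases hodd with ⟨j, hj⟩
    omega
  have hcardL : Fintype.card L = (q ^ k) ^ 2 := by
    rw [Module.card_eq_pow_finrank (K := F) (V := L), hn, ← pow_mul, mul_comm k 2]
  set M := q ^ k with hM
  have hMp : M = p ^ (f * k) := by rw [hM, hq, hqf, pow_mul]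
  obtain ⟨N, hN⟩ : Odd M := hodd.pow
  have hM3 : q ^ 3 ≤ M := Nat.pow_le_pow_right (by omega) hk
  have hqN : 2 * q + 3 ≤ N := by
    have : 9 * q ≤ q ^ 3 := by
      have : 3 * 3 ≤ q * q := Nat.mul_le_mul hq3 hq3
      nlinarith
    omega
  have h20 : (2 : L) ≠ 0 := by
    apply Ring.two_ne_zero
    intro h
    have := FiniteField.even_card_of_char_two h
    rw [hcardL, hN] at this
    have h2 : (2 * N + 1) ^ 2 = 2 * (2 * N ^ 2 + 2 * N) + 1 := by ring
    omega
  set a' := algebraMap F L a with ha'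
  set b' := algebraMap F L b with hb'
  have ha0 : a' ≠ 0 := by rw [ha']; simpa using ha
  have hb0 : b' ≠ 0 := by rw [hb']; simpa using hb
  obtain ⟨e, hec, he2⟩ := wk_exists_e (L := L) hodd (by omega) c (4 * a' * b')
  set P : L[X] := X ^ q - X + C e with hP
  set δ : L := 4 * a' * b' with hδ
  have hδ0 : δ ≠ 0 := by
    rw [hδ]
    have : (4 : L) = 2 * 2 := by norm_num
    rw [this]
    exact mul_ne_zero (mul_ne_zero (mul_ne_zero h20 h20) ha0) hb0
  set h : L[X] := P ^ 2 - C δ with hh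
  have hheval : ∀ y, h.eval y = (y ^ q - y + e) ^ 2 - δ := by
    intro y; simp [hh, hP]
  have hcoef : h.coeff 0 ≠ 0 := by
    rw [coeff_zero_eq_eval_zero, hheval, zero_pow (by omega)]
    simpa [sub_eq_zero] using he2
  have hPdeg : P.natDegree = q := by
    rw [hP]; compute_degree!
    · have : q ≠ 1 := by omega
      have h0 : q ≠ 0 := by omega
      simp [h0, this.symm]
    · omega
  have hdeg : h.natDegree = 2 * q := by
    rw [hh, natDegree_sub_C, natDegree_pow, hPdeg]
  have hunit : ¬ IsUnit h := by
    intro hu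
    have := natDegree_eq_zero_of_isUnit hu
    omega
  have hqL : (q : L) = 0 := by
    have : (q : F) = 0 := by rw [hq]; exact FiniteField.cast_card_eq_zero F
    rw [← map_natCast (algebraMap F L), this, map_zero]
  have hder : derivative h = - 2 * P := by
    rw [hh, hP]
    simp only [derivative_sub, derivative_pow, derivative_add, derivative_X, derivative_C, hqL, C_0]
    simp [show (C 2 : L[X]) = 2 from rfl]
  have hsq : Squarefree h := by
    apply Separable.squarefree
    refine ⟨-C δ⁻¹, - C δ⁻¹ * C (2 : L)⁻¹ * P, ?_⟩
    rw [hder, hh]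
    have e1 : C δ⁻¹ * C δ = (1 : L[X]) := by rw [← C_mul, inv_mul_cancel₀ hδ0, C_1]
    have e2 : C (2 : L)⁻¹ * 2 = (1 : L[X]) := by
      have : (2 : L[X]) = C 2 := rfl
      rw [this, ← C_mul, inv_mul_cancel₀ h20, C_1]
    linear_combination e1 + C δ⁻¹ * P ^ 2 * e2
  set S : Finset L := Finset.univ.filter (fun y => (h.eval y) ^ (2 * N * (N + 1)) = 1) with hS
  have hstep := wk_stepanov p (f * k) M N q hMp hN (by omega) hqN hcardL h hcoef hsq hunit hdeg.le S
    (by intro y hy; simpa [hS] using hy)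
  set Z : Finset L := h.roots.toFinset with hZ
  have hh0 : h ≠ 0 := hsq.ne_zero
  have hZc : Z.card ≤ 2 * q := by
    rw [← hdeg]; exact (Multiset.toFinset_card_le _).trans (card_roots' h)
  -- the points
  set W : Finset (L × L) := Finset.univ.filter (fun t => t.2 ^ 2 = h.eval t.1) with hW
  have hWc : W.card ≤ 2 * (S ∪ Z).card := by
    apply Finset.card_le_mul_card_image_of_maps_to (f := Prod.fst)
    · rintro ⟨y, w⟩ hyw
      simp only [hW, Finset.mem_filter, Finset.mem_univ, true_and] at hyw
      simp only [Finset.mem_union]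
      by_cases hw : w = 0
      · right
        rw [hZ, Multiset.mem_toFinset, mem_roots hh0, IsRoot, ← hyw, hw]; simp
      · left
        simp only [hS, Finset.mem_filter, Finset.mem_univ, true_and]
        rw [← hyw, ← pow_mul]
        have := FiniteField.pow_card_sub_one_eq_one w hw
        rw [hcardL, hN] at this
        convert this using 2
        have h2 : (2 * N + 1) ^ 2 = 2 * (2 * N * (N + 1)) + 1 := by ring
        omega
    · intro y _
      by_cases hex : ∃ w0 : L, w0 ^ 2 = h.eval y
      · obtain ⟨w0, hw0⟩ := hex
        refine (Finset.card_le_card (t := {(y, w0), (y, -w0)}) ?_).trans Finset.card_le_two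
        rintro ⟨y', w⟩ hm
        simp only [hW, Finset.mem_filter, Finset.mem_univ, true_and] at hm
        obtain ⟨h1, rfl⟩ := hm
        rw [← hw0, sq_eq_sq_iff_eq_or_eq_neg] at h1
        simpa using h1
      · have : ({x ∈ W | x.1 = y} : Finset (L × L)) = ∅ := by
          rw [Finset.eq_empty_iff_forall_notMem]
          rintro ⟨y', w⟩ hm
          simp only [hW, Finset.mem_filter, Finset.mem_univ, true_and] at hm
          obtain ⟨h1, rfl⟩ := hm
          exact hex ⟨w, h1⟩
        rw [this]; simp
  have hy0 : ∀ x ∈ A, ∃ y : L, y ^ q - y = a' * x + b' * x⁻¹ - e := by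
    intro x hx
    apply wk_hilbert
    rw [map_sub, (hA x hx).2, hec, sub_self]
  choose! y0 hy0 using hy0
  have hfq : ∀ g : F, (algebraMap F L g) ^ q = algebraMap F L g := by
    intro g; rw [← map_pow, hq, FiniteField.pow_card]
  have hadd : ∀ y : L, ∀ g : F, (y + algebraMap F L g) ^ q = y ^ q + algebraMap F L g := by
    intro y g
    rw [← hfq g, hq, hqf, add_pow_char_pow, ← hqf, ← hq, hfq, hfq]
  have hinj : (A ×ˢ (Finset.univ : Finset F)).card ≤ W.card := by
    apply Finset.card_le_card_of_injOn
      (fun t => (y0 t.1 + algebraMap F L t.2, 2 * a' * t.1 - (y0 t.1 ^ q - y0 t.1 + e)))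
    · rintro ⟨x, g⟩ hm
      simp only [Finset.coe_product, Set.mem_prod, Finset.mem_coe] at hm
      have hx0 := (hA x hm.1).1
      have hy := hy0 x hm.1
      simp only [hW, Finset.coe_filter, Finset.mem_univ, true_and, Set.mem_ofPred_eq, hheval, hadd]
      have e1 : y0 x ^ q + algebraMap F L g - (y0 x + algebraMap F L g) = y0 x ^ q - y0 x := by ring
      rw [e1, hy, hδ]
      field_simp
      ring
    · rintro ⟨x, g⟩ hm ⟨x', g'⟩ hm' heq
      simp only [Finset.coe_product, Set.mem_prod, Finset.mem_coe] at hm hm'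
      simp only [Prod.mk.injEq] at heq
      obtain ⟨h1, h2⟩ := heq
      have e1 : y0 x ^ q - y0 x = y0 x' ^ q - y0 x' := by
        have := congrArg (fun y => y ^ q - y) h1
        simp only [hadd] at this
        linear_combination this
      rw [e1] at h2
      have e2 : x = x' := by
        have : 2 * a' * x = 2 * a' * x' := by linear_combination h2
        exact mul_left_cancel₀ (mul_ne_zero h20 ha0) this
      subst e2
      have e3 := (algebraMap F L).injective (add_left_cancel h1)
      rw [e3]
  rw [Finset.card_product, Finset.card_univ, ← hq] at hinj
  have hU := Finset.card_union_le S Z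
  have e1 : q ^ (2 * k) = M ^ 2 := by rw [hM, ← pow_mul, mul_comm]
  rw [e1]
  have : q ≤ q * M := Nat.le_mul_of_pos_right _ (by omega)
  nlinarith
end


/-- The Kloosterman sum over an extension. -/
noncomputable def wkK {F : Type*} [Field F] (ψ : AddChar F ℂ) (a b : F)
    (L : Type*) [Field L] [Fintype L] [Algebra F L] : ℂ :=
  open Classical in
  ∑ x : L, if x = 0 then 0 else
    ψ (Algebra.trace F L (algebraMap F L a * x + algebraMap F L b * x⁻¹))

theorem wkK_bound {F L : Type*} [Field F] [Fintype F] [Field L] [Fintype L] [Algebra F L]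
    (ψ : AddChar F ℂ) (hψ : ψ ≠ 1)
    (hodd : Odd (Fintype.card F)) (k : ℕ) (hk : 3 ≤ k)
    (hn : Module.finrank F L = 2 * k) (a b : F) (ha : a ≠ 0) (hb : b ≠ 0) :
    ‖wkK ψ a b L‖ ≤ 11 * (Fintype.card F : ℝ) * (Fintype.card F : ℝ) ^ k := by
  classical
  set q := Fintype.card F with hq
  have hq1 : 1 ≤ q := Fintype.card_pos
  have hq0 : (0 : ℝ) < q := by exact_mod_cast hq1
  let g : L → F := fun x => Algebra.trace F L (algebraMap F L a * x + algebraMap F L b * x⁻¹)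
  let A : F → Finset L := fun c => Finset.univ.filter (fun x => x ≠ 0 ∧ g x = c)
  have h1 : wkK ψ a b L = ∑ c : F, ψ c * ((A c).card : ℂ) := by
    unfold wkK
    rw [← Finset.sum_fiberwise (s := Finset.univ) (g := g)]
    apply Finset.sum_congr rfl
    intro c _
    have : ∀ x ∈ Finset.univ.filter (fun x => g x = c), (if x = 0 then (0 : ℂ) else
      ψ (Algebra.trace F L (algebraMap F L a * x + algebraMap F L b * x⁻¹)))
       = if x ≠ 0 then ψ c else 0 := by
      intro x hx
      have hx : g x = c := by simpa using hx
      rw [← hx]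
      by_cases h : x = 0 <;> simp [h, g]
    rw [Finset.sum_congr rfl this, ← Finset.sum_filter, Finset.sum_const, Finset.filter_filter, nsmul_eq_mul,
      mul_comm]
    congr 3
    ext x; simp only [A, Finset.mem_filter]; tauto
  have h2 : ∑ c : F, (A c).card = q ^ (2 * k) - 1 := by
    have e := Finset.card_eq_sum_card_fiberwise (s := Finset.univ.filter (fun x : L => x ≠ 0))
      (t := (Finset.univ : Finset F)) (f := g) (by intro x _; simp)
    simp only [Finset.filter_filter] at e
    rw [← e, Finset.filter_ne', Finset.card_erase_of_mem (Finset.mem_univ _), Finset.card_univ,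
      Module.card_eq_pow_finrank (K := F) (V := L), hn]
  set B : ℝ := (q : ℝ) ^ (2 * k) / q + 10 * q ^ k with hB
  have h3 : ∀ c, ((A c).card : ℝ) ≤ B := by
    intro c
    have := wk_count hodd k hk hn a b c ha hb (A c) (by intro x hx; simpa [A, g] using hx)
    have h' : (q : ℝ) * (A c).card ≤ (q : ℝ) ^ (2 * k) + 10 * q * (q : ℝ) ^ k := by exact_mod_cast this
    rw [hB, ← mul_le_mul_iff_right₀ hq0]
    refine h'.trans (le_of_eq ?_)
    field_simp
  have h4 : wkK ψ a b L = ∑ c : F, ψ c * (((A c).card : ℂ) - (B : ℂ)) := by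
    simp only [mul_sub]
    rw [Finset.sum_sub_distrib, ← Finset.sum_mul, AddChar.sum_eq_zero_of_ne_one hψ, h1]; simp
  rw [h4]
  refine (norm_sum_le _ _).trans ?_
  have h5 : ∀ c ∈ (Finset.univ : Finset F), ‖ψ c * (((A c).card : ℂ) - (B : ℂ))‖ = B - (A c).card := by
    intro c _
    rw [norm_mul, AddChar.norm_apply, one_mul]
    have : (((A c).card : ℂ) - (B : ℂ)) = (((A c).card - B : ℝ) : ℂ) := by push_cast; rfl
    rw [this, Complex.norm_real, Real.norm_eq_abs, abs_of_nonpos (by linarith [h3 c])]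
    ring
  rw [Finset.sum_congr rfl h5, Finset.sum_sub_distrib, Finset.sum_const, Finset.card_univ, ← hq,
    ← Nat.cast_sum, h2, nsmul_eq_mul, Nat.cast_sub (Nat.one_le_pow _ _ hq1), hB]
  push_cast
  have : (1 : ℝ) ≤ (q : ℝ) * (q : ℝ) ^ k := by
    rw [← pow_succ']; exact one_le_pow₀ (by exact_mod_cast hq1)
  field_simp
  nlinarith


section
open Polynomial

/-- The multiplicative function on monic polynomials attached to Kloosterman sums. -/
noncomputable def wkLam {F : Type*} [Field F] (ψ : AddChar F ℂ) (a b : F) (f : F[X]) : ℂ :=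
  open Classical in
  if f.coeff 0 = 0 then 0 else ψ (-(a * f.nextCoeff) - b * (f.coeff 1 / f.coeff 0))

section
variable {F : Type*} [Field F] (ψ : AddChar F ℂ) (a b : F)

theorem wkLam_one : wkLam ψ a b 1 = 1 := by
  have : (1 : F[X]).nextCoeff = 0 := by simp [nextCoeff]
  simp [wkLam, this, coeff_one]

theorem wkLam_mul (f g : F[X]) (hf : f.Monic) (hg : g.Monic) :
    wkLam ψ a b (f * g) = wkLam ψ a b f * wkLam ψ a b g := by
  unfold wkLam
  rw [mul_coeff_zero, hf.nextCoeff_mul hg, mul_coeff_one]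
  by_cases h1 : f.coeff 0 = 0
  · simp [h1]
  by_cases h2 : g.coeff 0 = 0
  · simp [h2]
  simp only [h1, h2, mul_eq_zero, or_self, if_false]
  rw [← AddChar.map_add_eq_mul]
  congr 1
  field_simp
  ring

theorem wkLam_pow (f : F[X]) (hf : f.Monic) (n : ℕ) :
    wkLam ψ a b (f ^ n) = wkLam ψ a b f ^ n := by
  induction n with
  | zero => simp [wkLam_one]
  | succ n ih => rw [pow_succ, wkLam_mul _ _ _ _ _ (hf.pow n) hf, ih, pow_succ]

end

section
variable {F L : Type*} [Field F] [Field L] [Algebra F L] [FiniteDimensional F L]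

theorem wk_adjoin_inv (x : L) : IntermediateField.adjoin F {x⁻¹} = IntermediateField.adjoin F {x} := by
  apply le_antisymm
  · rw [IntermediateField.adjoin_simple_le_iff]
    exact inv_mem (IntermediateField.mem_adjoin_simple_self F x)
  · rw [IntermediateField.adjoin_simple_le_iff]
    have := inv_mem (IntermediateField.mem_adjoin_simple_self F x⁻¹)
    rwa [inv_inv] at this

theorem wk_minpoly_inv (x : L) (hx : x ≠ 0) :
    (minpoly F x⁻¹).nextCoeff = (minpoly F x).coeff 1 / (minpoly F x).coeff 0 := by
  set P := minpoly F x with hP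
  have hIntg : IsIntegral F x := .of_finite F x
  have hIntg' : IsIntegral F x⁻¹ := .of_finite F _
  have hc0 : P.coeff 0 ≠ 0 := minpoly.coeff_zero_ne_zero hIntg hx
  have hdeg : (minpoly F x⁻¹).natDegree = P.natDegree := by
    rw [hP, ← IntermediateField.adjoin.finrank hIntg, ← IntermediateField.adjoin.finrank hIntg',
      wk_adjoin_inv]
  have hpos : 0 < P.natDegree := minpoly.natDegree_pos hIntg
  have htr : P.natTrailingDegree = 0 := natTrailingDegree_eq_zero.2 (Or.inr hc0)
  have hrd : P.reverse.natDegree = P.natDegree := by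
    rw [reverse_natDegree, htr, Nat.sub_zero]
  have hrl : P.reverse.leadingCoeff = P.coeff 0 := by
    rw [reverse_leadingCoeff, trailingCoeff, htr]
  have hroot : aeval x⁻¹ P.reverse = 0 := by
    letI := invertibleOfNonzero hx
    have := (eval₂_reverse_eq_zero_iff (algebraMap F L) x P).2 (minpoly.aeval F x)
    rwa [invOf_eq_inv] at this
  have heq : minpoly F x⁻¹ = C (P.coeff 0)⁻¹ * P.reverse := by
    symm
    apply eq_of_monic_of_dvd_of_natDegree_le (minpoly.monic hIntg')
    · rw [Monic, leadingCoeff_mul, leadingCoeff_C, hrl, inv_mul_cancel₀ hc0]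
    · apply minpoly.dvd
      rw [map_mul, hroot, mul_zero]
    · rw [natDegree_C_mul (inv_ne_zero hc0), hrd, hdeg]
  rw [nextCoeff_of_natDegree_pos (by omega), hdeg, heq, coeff_C_mul, coeff_reverse, revAt_le (by omega)]
  have : P.natDegree - (P.natDegree - 1) = 1 := by omega
  rw [this]; field_simp

theorem wk_term (ψ : AddChar F ℂ) (a b : F) (x : L) (hx : x ≠ 0) :
    ψ (Algebra.trace F L (algebraMap F L a * x + algebraMap F L b * x⁻¹)) =
      wkLam ψ a b (minpoly F x) ^ (Module.finrank F L / (minpoly F x).natDegree) := by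
  have hIntg : IsIntegral F x := .of_finite F x
  have hpos : 0 < (minpoly F x).natDegree := minpoly.natDegree_pos hIntg
  have hc0 : (minpoly F x).coeff 0 ≠ 0 := minpoly.coeff_zero_ne_zero hIntg hx
  have h1 : Module.finrank F L / (minpoly F x).natDegree
      = Module.finrank (IntermediateField.adjoin F {x}) L := by
    rw [← IntermediateField.adjoin.finrank hIntg,
      ← Module.finrank_mul_finrank F (IntermediateField.adjoin F {x}) L]
    apply Nat.mul_div_cancel_left
    rw [IntermediateField.adjoin.finrank hIntg]; exact hpos
  rw [h1, wkLam, if_neg hc0, ← AddChar.map_nsmul_eq_pow]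
  congr 1
  rw [map_add, ← Algebra.smul_def, ← Algebra.smul_def, map_smul, map_smul,
    trace_eq_finrank_mul_minpoly_nextCoeff, trace_eq_finrank_mul_minpoly_nextCoeff,
    wk_minpoly_inv x hx, wk_adjoin_inv]
  simp only [smul_eq_mul, nsmul_eq_mul]
  ring
end

section
variable {F L : Type*} [Field F] [Fintype F] [Field L] [Fintype L] [Algebra F L]

theorem wk_fiber_card [DecidableEq L] (P : F[X]) (hP : Irreducible P) (hm : P.Monic)
    (hd : P.natDegree ∣ Module.finrank F L) (A : Finset L) (hA : ∀ x, x ∈ A ↔ minpoly F x = P) :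
    A.card = P.natDegree := by
  have h1 : P ∣ X ^ (Nat.card F) ^ (Module.finrank F L) - X :=
    hP.natDegree_dvd_iff_dvd_X_pow_card_pow_sub_X.1 hd
  have hc : (Nat.card F) ^ (Module.finrank F L) = Fintype.card L := by
    rw [Nat.card_eq_fintype_card, ← Module.card_eq_pow_finrank]
  rw [hc] at h1
  have h2 : P.map (algebraMap F L) ∣ X ^ Fintype.card L - X := by
    have := map_dvd (mapRingHom (algebraMap F L)) h1
    simpa using this
  have hne : (X ^ Fintype.card L - X : L[X]) ≠ 0 := FiniteField.X_pow_card_sub_X_ne_zero L Fintype.one_lt_card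
  have hsp : (X ^ Fintype.card L - X : L[X]).Splits := by
    rw [splits_iff_card_roots, FiniteField.roots_X_pow_card_sub_X,
      FiniteField.X_pow_card_sub_X_natDegree_eq L Fintype.one_lt_card]
    rfl
  have hsp2 : (P.map (algebraMap F L)).Splits := hsp.of_dvd hne h2
  have hnd : (P.map (algebraMap F L)).roots.Nodup := by
    refine Multiset.nodup_of_le (roots.le_of_dvd hne h2) ?_
    rw [FiniteField.roots_X_pow_card_sub_X]
    exact Finset.univ.nodup
  have h3 := splits_iff_card_roots.1 hsp2
  rw [natDegree_map] at h3
  rw [← h3, ← Multiset.toFinset_card_of_nodup hnd]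
  congr 1
  ext x
  rw [hA, Multiset.mem_toFinset, mem_roots (Polynomial.map_ne_zero hP.ne_zero), IsRoot, eval_map_algebraMap]
  constructor
  · rintro rfl; exact minpoly.aeval F x
  · intro h; exact (minpoly.eq_of_irreducible_of_monic hP h hm).symm

/-- `K_j` as a sum over irreducible polynomials -/
theorem wkK_eq (ψ : AddChar F ℂ) (a b : F) (I : Finset F[X])
    (hI : ∀ P, P ∈ I ↔ P.Monic ∧ Irreducible P ∧ P.natDegree ∣ Module.finrank F L) :
    wkK ψ a b L = ∑ P ∈ I, (P.natDegree : ℂ) * wkLam ψ a b P ^ (Module.finrank F L / P.natDegree) := by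
  classical
  unfold wkK
  rw [← Finset.sum_fiberwise_of_maps_to (s := Finset.univ) (t := I) (g := fun x : L => minpoly F x)]
  · apply Finset.sum_congr rfl
    intro P hP
    obtain ⟨hm, hirr, hd⟩ := (hI P).1 hP
    rw [Finset.sum_congr rfl (g := fun _ => wkLam ψ a b P ^ (Module.finrank F L / P.natDegree))]
    · rw [Finset.sum_const, nsmul_eq_mul, wk_fiber_card P hirr hm hd _ (by intro x; simp)]
    · intro x hx
      have hx : minpoly F x = P := by simpa using hx
      subst hx
      split_ifs with h0
      · subst h0
        rw [minpoly.zero]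
        have : Module.finrank F L ≠ 0 := Module.finrank_pos.ne'
        simp [wkLam, this]
      · exact wk_term ψ a b x h0
  · intro x _
    have hIntg : IsIntegral F x := .of_finite F x
    rw [hI]
    refine ⟨minpoly.monic hIntg, minpoly.irreducible hIntg, ?_⟩
    rw [← IntermediateField.adjoin.finrank hIntg,
      ← Module.finrank_mul_finrank F (IntermediateField.adjoin F {x}) L]
    exact Dvd.intro _ rfl
end

end


section
open Polynomial
variable {F : Type*} [Field F] [Fintype F]

theorem wkMon_finite (F : Type*) [Field F] [Fintype F] (n : ℕ) :
    {f : F[X] | f.Monic ∧ f.natDegree = n}.Finite := by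
  refine Set.Finite.subset (Set.finite_range
    (fun c : Fin (n + 1) → F => ∑ i : Fin (n + 1), C (c i) * X ^ (i : ℕ))) ?_
  rintro f ⟨-, hf⟩
  refine ⟨fun i => f.coeff i, ?_⟩
  simp only
  rw [Fin.sum_univ_eq_sum_range (fun i => C (f.coeff i) * X ^ i) (n + 1), ← hf]
  exact (f.as_sum_range_C_mul_X_pow).symm

/-- monic polynomials of degree n -/
noncomputable def wkMon (F : Type*) [Field F] [Fintype F] (n : ℕ) : Finset F[X] :=
  (wkMon_finite F n).toFinset

theorem mem_wkMon (n : ℕ) (f : F[X]) : f ∈ wkMon F n ↔ f.Monic ∧ f.natDegree = n := by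
  simp [wkMon]

/-- coefficients of the L-function -/
noncomputable def wkS (ψ : AddChar F ℂ) (a b : F) (n : ℕ) : ℂ := ∑ f ∈ wkMon F n, wkLam ψ a b f

theorem wkS_zero (ψ : AddChar F ℂ) (a b : F) : wkS ψ a b 0 = 1 := by
  have : wkMon F 0 = {1} := by
    ext f
    rw [mem_wkMon, Finset.mem_singleton]
    constructor
    · rintro ⟨h1, h2⟩
      exact h1.natDegree_eq_zero.1 h2
    · rintro rfl
      simp
  rw [wkS, this, Finset.sum_singleton, wkLam_one]

theorem wkS_one (ψ : AddChar F ℂ) (a b : F) : wkS ψ a b 1 =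
    open Classical in ∑ x : F, if x = 0 then 0 else ψ (a * x + b * x⁻¹) := by
  classical
  rw [wkS]
  symm
  refine Finset.sum_bij' (fun x _ => X + C (-x)) (fun f _ => - f.coeff 0) ?_ ?_ ?_ ?_ ?_
  · intro x _
    rw [mem_wkMon]
    exact ⟨monic_X_add_C _, natDegree_X_add_C _⟩
  · simp
  · simp
  · intro f hf
    rw [mem_wkMon] at hf
    have := Monic.eq_X_add_C hf.1 hf.2
    rw [neg_neg, ← this]
  · intro x _
    have h0 : (X + C (-x)).coeff 0 = -x := by simp
    have h1 : (X + C (-x)).coeff 1 = 1 := by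
      rw [coeff_add, coeff_X_one, coeff_C]; simp
    rw [wkLam, h0, h1, nextCoeff_X_add_C]
    by_cases hx : x = 0
    · simp [hx]
    · rw [if_neg hx, if_neg (neg_ne_zero.2 hx)]
      congr 1
      field_simp
      ring

theorem wk_natDegree_two (u v : F) : (X ^ 2 + (C u * X + C v)).natDegree = 2 := by
  have := natDegree_quadratic (R := F) (a := 1) (b := u) (c := v) one_ne_zero
  rwa [C_1, one_mul, add_assoc] at this

theorem wkS_two (ψ : AddChar F ℂ) (hψ : ψ ≠ 1) (a b : F) (ha : a ≠ 0) (hb : b ≠ 0) :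
    wkS ψ a b 2 = Fintype.card F := by
  classical
  have hprim : ψ.IsPrimitive := AddChar.IsPrimitive.of_ne_one hψ
  have h1 : wkS ψ a b 2 = ∑ p : F × F, if p.1 = 0 then 0 else ψ (p.2 * (-(a + b / p.1))) := by
    rw [wkS]
    symm
    refine Finset.sum_bij' (fun p _ => X ^ 2 + (C p.2 * X + C p.1))
      (fun f _ => (f.coeff 0, f.coeff 1)) ?_ ?_ ?_ ?_ ?_
    · intro p _
      rw [mem_wkMon]
      have hl : (C p.2 * X + C p.1).degree < ((2 : ℕ) : WithBot ℕ) :=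
        lt_of_le_of_lt degree_linear_le (by norm_num)
      refine ⟨monic_X_pow_add (by simpa using hl), ?_⟩
      have := wk_natDegree_two p.2 p.1
      exact this
    · simp
    · intro p _
      ext <;> simp [coeff_X, coeff_C]
    · intro f hf
      rw [mem_wkMon] at hf
      have h2 := f.as_sum_range_C_mul_X_pow
      have h3 : f.coeff 2 = 1 := by
        have := hf.1.coeff_natDegree
        rwa [hf.2] at this
      rw [hf.2, Finset.sum_range_succ, Finset.sum_range_succ, Finset.sum_range_one, h3] at h2
      conv_rhs => rw [h2]
      simp
      ring
    · intro p _
      have hl : (C p.2 * X + C p.1).degree < ((2 : ℕ) : WithBot ℕ) :=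
        lt_of_le_of_lt degree_linear_le (by norm_num)
      have hd := wk_natDegree_two p.2 p.1
      have c0 : (X ^ 2 + (C p.2 * X + C p.1)).coeff 0 = p.1 := by simp
      have c1 : (X ^ 2 + (C p.2 * X + C p.1)).coeff 1 = p.2 := by
        simp [coeff_X, coeff_C]
      rw [wkLam, c0, c1, nextCoeff_of_natDegree_pos (by rw [hd]; norm_num), hd, c1]
      by_cases hx : p.1 = 0
      · simp [hx]
      · rw [if_neg hx, if_neg hx]
        congr 1
        field_simp
        ring
  rw [h1, Fintype.sum_prod_type]
  have h2 : ∀ x : F, (∑ y : F, if x = 0 then (0 : ℂ) else ψ (y * (-(a + b / x)))) =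
      if x = - b / a then (Fintype.card F : ℂ) else 0 := by
    intro x
    by_cases hx : x = 0
    · have : ¬ (x = -b / a) := by
        rw [hx]; intro h
        have := h.symm
        simp [ha, hb] at this
      simp [hx, ha, hb]
      intro h
      exfalso
      rw [hx] at this
      exact this h
    · simp only [if_neg hx]
      rw [AddChar.sum_mulShift _ hprim]
      have : (-(a + b / x) = 0) ↔ x = - b / a := by
        constructor
        · intro h
          field_simp at h ⊢
          linear_combination (-1 : F) * h
        · rintro rfl
          field_simp
          ring
      simp only [this]
      split_ifs <;> simp
  simp only [h2]
  simp

theorem wkS_ge (ψ : AddChar F ℂ) (hψ : ψ ≠ 1) (a b : F) (ha : a ≠ 0) (n : ℕ) (hn : 3 ≤ n) :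
    wkS ψ a b n = 0 := by
  classical
  obtain ⟨v, hv⟩ : ∃ v, ψ v ≠ 1 := by
    by_contra h
    push Not at h
    exact hψ (by ext x; simp [h x])
  set u : F := - v / a with hu
  have hau : -(a * u) = v := by rw [hu]; field_simp
  have key : wkS ψ a b n = ψ v * wkS ψ a b n := by
    conv_rhs => rw [wkS, Finset.mul_sum]
    rw [wkS]
    have hmem : ∀ (w : F) (f : F[X]), f ∈ wkMon F n → f + C w * X ^ (n - 1) ∈ wkMon F n := by
      intro w f hf
      rw [mem_wkMon] at hf ⊢
      have hlt : (C w * X ^ (n - 1)).degree < f.degree := by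
        rw [degree_eq_natDegree hf.1.ne_zero]
        refine lt_of_le_of_lt (degree_C_mul_X_pow_le _ _) ?_
        rw [hf.2]
        exact_mod_cast (by omega : n - 1 < n)
      refine ⟨hf.1.add_of_left hlt, ?_⟩
      rw [natDegree_add_eq_left_of_degree_lt hlt, hf.2]
    symm
    refine Finset.sum_bij' (fun f _ => f + C u * X ^ (n - 1)) (fun f _ => f + C (-u) * X ^ (n - 1))
      (fun f hf => hmem u f hf) (fun f hf => hmem (-u) f hf) ?_ ?_ ?_
    · intro f _; simp
    · intro f _; simp
    · intro f hf
      have hf' := hmem u f hf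
      rw [mem_wkMon] at hf hf'
      have c0 : (f + C u * X ^ (n - 1)).coeff 0 = f.coeff 0 := by
        rw [coeff_add, coeff_C_mul, coeff_X_pow, if_neg (by omega)]; simp
      have c1 : (f + C u * X ^ (n - 1)).coeff 1 = f.coeff 1 := by
        rw [coeff_add, coeff_C_mul, coeff_X_pow, if_neg (by omega)]; simp
      have cn : (f + C u * X ^ (n - 1)).nextCoeff = f.nextCoeff + u := by
        rw [nextCoeff_of_natDegree_pos (by omega), nextCoeff_of_natDegree_pos (by omega), hf'.2,
          hf.2, coeff_add, coeff_C_mul, coeff_X_pow, if_pos rfl, mul_one]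
      rw [wkLam, wkLam, c0, c1, cn]
      by_cases hx : f.coeff 0 = 0
      · simp [hx]
      · rw [if_neg hx, if_neg hx, ← AddChar.map_add_eq_mul]
        congr 1
        rw [← hau]
        ring
  have : (1 - ψ v) * wkS ψ a b n = 0 := by rw [sub_mul, one_mul, ← key, sub_self]
  rcases mul_eq_zero.1 this with h | h
  · exact absurd (sub_eq_zero.1 h).symm hv
  · exact h

end


section
open Polynomial
variable {F : Type*} [Field F] [Fintype F]

/-- monic irreducible polynomials of degree at most n -/
noncomputable def wkIrr (F : Type*) [Field F] [Fintype F] (n : ℕ) : Finset F[X] :=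
  open Classical in {P ∈ (Finset.range (n + 1)).biUnion (wkMon F) | Irreducible P}

theorem mem_wkIrr (n : ℕ) (P : F[X]) :
    P ∈ wkIrr F n ↔ P.Monic ∧ Irreducible P ∧ P.natDegree ≤ n := by
  classical
  simp only [wkIrr, Finset.mem_filter, Finset.mem_biUnion, Finset.mem_range, mem_wkMon]
  constructor
  · rintro ⟨⟨m, hm, h1, h2⟩, h3⟩
    exact ⟨h1, h3, by omega⟩
  · rintro ⟨h1, h2, h3⟩
    exact ⟨⟨P.natDegree, by omega, h1, rfl⟩, h2⟩

open Classical in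
theorem wk_deg_eq (n : ℕ) (f : F[X]) (hf : f ∈ wkMon F n) :
    ∑ P ∈ wkIrr F n, ∑ k ∈ Finset.Icc 1 n, (if P ^ k ∣ f then P.natDegree else 0) = n := by
  rw [mem_wkMon] at hf
  obtain ⟨hm, hdeg⟩ := hf
  have hf0 : f ≠ 0 := hm.ne_zero
  set s := UniqueFactorizationMonoid.normalizedFactors f with hs
  have hprod : s.prod = f := by
    rw [hs, UniqueFactorizationMonoid.prod_normalizedFactors_eq hf0, hm.normalize_eq_self]
  have hirr : ∀ P ∈ s, Irreducible P := fun P hP =>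
    UniqueFactorizationMonoid.irreducible_of_normalized_factor P hP
  have hmon : ∀ P ∈ s, P.Monic := fun P hP => by
    have h1 := UniqueFactorizationMonoid.normalize_normalized_factor P hP
    rw [← h1]
    exact monic_normalize (hirr P hP).ne_zero
  have hd := natDegree_multiset_prod_of_monic s hmon
  rw [hprod, hdeg, Finset.sum_multiset_map_count] at hd
  have hsub : s.toFinset ⊆ wkIrr F n := by
    intro P hP
    rw [Multiset.mem_toFinset] at hP
    rw [mem_wkIrr]
    refine ⟨hmon P hP, hirr P hP, ?_⟩
    rw [← hdeg]
    exact natDegree_le_of_dvd (UniqueFactorizationMonoid.dvd_of_mem_normalizedFactors hP) hf0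
  have hinner : ∀ P ∈ wkIrr F n, (∑ k ∈ Finset.Icc 1 n, (if P ^ k ∣ f then P.natDegree else 0)) =
      s.count P • P.natDegree := by
    intro P hP
    rw [mem_wkIrr] at hP
    have hem := UniqueFactorizationMonoid.emultiplicity_eq_count_normalizedFactors hP.2.1 hf0
    rw [hP.1.normalize_eq_self, ← hs] at hem
    have hiff : ∀ k, P ^ k ∣ f ↔ k ≤ s.count P := by
      intro k
      rw [pow_dvd_iff_le_emultiplicity, hem]
      exact Nat.cast_le
    have hc : s.count P ≤ n := by
      have h1 := natDegree_le_of_dvd ((hiff (s.count P)).2 le_rfl) hf0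
      rw [natDegree_pow, hdeg] at h1
      have h2 := hP.2.1.natDegree_pos
      nlinarith
    rw [← Finset.sum_filter, Finset.sum_const]
    congr 1
    have : {k ∈ Finset.Icc 1 n | P ^ k ∣ f} = Finset.Icc 1 (s.count P) := by
      ext k
      simp only [Finset.mem_filter, Finset.mem_Icc, hiff]
      omega
    rw [this, Nat.card_Icc]
    omega
  rw [Finset.sum_congr rfl hinner]
  conv_rhs => rw [hd]
  symm
  apply Finset.sum_subset hsub
  intro P _ hP
  rw [Multiset.mem_toFinset] at hP
  rw [Multiset.count_eq_zero_of_notMem hP, zero_smul]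

open Classical in
theorem wk_sum_dvd (ψ : AddChar F ℂ) (a b : F) (n k : ℕ) (P : F[X]) (hP : P.Monic)
    (hk : k * P.natDegree ≤ n) :
    (∑ f ∈ wkMon F n, if P ^ k ∣ f then wkLam ψ a b f else 0) =
      wkLam ψ a b P ^ k * wkS ψ a b (n - k * P.natDegree) := by
  rw [← Finset.sum_filter, wkS, Finset.mul_sum]
  symm
  refine Finset.sum_bij (fun g _ => P ^ k * g) ?_ ?_ ?_ ?_
  · intro g hg
    rw [mem_wkMon] at hg
    rw [Finset.mem_filter, mem_wkMon]
    refine ⟨⟨(hP.pow k).mul hg.1, ?_⟩, dvd_mul_right _ _⟩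
    rw [(hP.pow k).natDegree_mul hg.1, hP.natDegree_pow, hg.2]
    omega
  · intro g1 _ g2 _ h
    exact mul_left_cancel₀ (hP.pow k).ne_zero h
  · intro f hf
    rw [Finset.mem_filter, mem_wkMon] at hf
    obtain ⟨⟨h1, h2⟩, g, rfl⟩ := hf
    have hg : g.Monic := (hP.pow k).of_mul_monic_left h1
    refine ⟨g, ?_, rfl⟩
    rw [mem_wkMon]
    refine ⟨hg, ?_⟩
    rw [(hP.pow k).natDegree_mul hg, hP.natDegree_pow] at h2
    omega
  · intro g hg
    rw [mem_wkMon] at hg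
    rw [wkLam_mul _ _ _ _ _ (hP.pow k) hg.1, wkLam_pow _ _ _ _ hP]

/-- power sums -/
noncomputable def wkP (ψ : AddChar F ℂ) (a b : F) (j : ℕ) : ℂ :=
  ∑ P ∈ wkIrr F j with P.natDegree ∣ j, (P.natDegree : ℂ) * wkLam ψ a b P ^ (j / P.natDegree)

theorem wk_newton (ψ : AddChar F ℂ) (a b : F) (n : ℕ) :
    (n : ℂ) * wkS ψ a b n = ∑ j ∈ Finset.Icc 1 n, wkP ψ a b j * wkS ψ a b (n - j) := by
  classical
  have h1 : (n : ℂ) * wkS ψ a b n = ∑ P ∈ wkIrr F n, ∑ k ∈ Finset.Icc 1 n,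
      (P.natDegree : ℂ) * ∑ f ∈ wkMon F n, if P ^ k ∣ f then wkLam ψ a b f else 0 := by
    rw [wkS, Finset.mul_sum]
    have : ∀ f ∈ wkMon F n, (n : ℂ) * wkLam ψ a b f = ∑ P ∈ wkIrr F n, ∑ k ∈ Finset.Icc 1 n,
      (P.natDegree : ℂ) * if P ^ k ∣ f then wkLam ψ a b f else 0 := by
      intro f hf
      conv_lhs => rw [← wk_deg_eq n f hf]
      rw [Nat.cast_sum, Finset.sum_mul]
      refine Finset.sum_congr rfl fun P _ => ?_
      rw [Nat.cast_sum, Finset.sum_mul]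
      refine Finset.sum_congr rfl fun k _ => ?_
      split_ifs <;> simp
    rw [Finset.sum_congr rfl this, Finset.sum_comm]
    refine Finset.sum_congr rfl fun P _ => ?_
    rw [Finset.sum_comm]
    refine Finset.sum_congr rfl fun k _ => ?_
    rw [Finset.mul_sum]
  rw [h1]
  have h2 : ∀ j ∈ Finset.Icc 1 n, wkP ψ a b j * wkS ψ a b (n - j) = ∑ P ∈ wkIrr F n,
      if P.natDegree ∣ j then (P.natDegree : ℂ) * wkLam ψ a b P ^ (j / P.natDegree) *
        wkS ψ a b (n - j) else 0 := by
    intro j hj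
    rw [Finset.mem_Icc] at hj
    rw [wkP, Finset.sum_mul, ← Finset.sum_filter]
    apply Finset.sum_congr _ (fun _ _ => rfl)
    ext P
    simp only [Finset.mem_filter, mem_wkIrr]
    constructor
    · rintro ⟨⟨h1, h2, h3⟩, h4⟩
      exact ⟨⟨h1, h2, by omega⟩, h4⟩
    · rintro ⟨⟨h1, h2, h3⟩, h4⟩
      exact ⟨⟨h1, h2, Nat.le_of_dvd (by omega) h4⟩, h4⟩
  rw [Finset.sum_congr rfl h2]
  conv_rhs => rw [Finset.sum_comm]
  refine Finset.sum_congr rfl fun P hP => ?_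
  rw [mem_wkIrr] at hP
  have hpos : 0 < P.natDegree := hP.2.1.natDegree_pos
  rw [← Finset.sum_filter]
  have h3 : ∀ k ∈ Finset.Icc 1 n, ¬ (k * P.natDegree ≤ n) → ((P.natDegree : ℂ) *
      ∑ f ∈ wkMon F n, if P ^ k ∣ f then wkLam ψ a b f else 0) = 0 := by
    intro k _ hk
    rw [Finset.sum_eq_zero, mul_zero]
    intro f hf
    rw [mem_wkMon] at hf
    rw [if_neg]
    intro hdvd
    have := natDegree_le_of_dvd hdvd hf.1.ne_zero
    rw [natDegree_pow, hf.2] at this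
    exact hk this
  rw [← Finset.sum_filter_add_sum_filter_not (Finset.Icc 1 n) (fun k => k * P.natDegree ≤ n),
    Finset.sum_eq_zero (s := {k ∈ Finset.Icc 1 n | ¬ (k * P.natDegree ≤ n)}), add_zero]
  · refine Finset.sum_bij' (fun k _ => k * P.natDegree) (fun j _ => j / P.natDegree) ?_ ?_ ?_ ?_ ?_
    · intro k hk
      rw [Finset.mem_filter, Finset.mem_Icc] at hk ⊢
      exact ⟨⟨Nat.mul_pos hk.1.1 hpos, hk.2⟩, dvd_mul_left _ _⟩
    · intro j hj
      rw [Finset.mem_filter, Finset.mem_Icc] at hj ⊢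
      obtain ⟨⟨h5, h6⟩, c, rfl⟩ := hj
      rw [Nat.mul_div_cancel_left _ hpos]
      have : 0 < c := by
        rcases Nat.eq_zero_or_pos c with h | h
        · subst h; simp at h5
        · exact h
      refine ⟨⟨this, ?_⟩, by rw [mul_comm]; exact h6⟩
      nlinarith
    · intro k _
      exact Nat.mul_div_cancel _ hpos
    · intro j hj
      rw [Finset.mem_filter] at hj
      exact Nat.div_mul_cancel hj.2
    · intro k hk
      rw [Finset.mem_filter] at hk
      rw [wk_sum_dvd _ _ _ _ _ _ hP.1 hk.2, Nat.mul_div_cancel _ hpos]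
      ring
  · intro k hk
    rw [Finset.mem_filter] at hk
    exact h3 k hk.1 hk.2

theorem wkP_bound (ψ : AddChar F ℂ) (hψ : ψ ≠ 1) (hodd : Odd (Fintype.card F)) (k : ℕ) (hk : 3 ≤ k)
    (a b : F) (ha : a ≠ 0) (hb : b ≠ 0) :
    ‖wkP ψ a b (2 * k)‖ ≤ 11 * (Fintype.card F : ℝ) * (Fintype.card F : ℝ) ^ k := by
  obtain ⟨p, hp⟩ := CharP.exists F
  haveI : Fact p.Prime := ⟨CharP.char_is_prime F p⟩
  haveI : NeZero (2 * k) := ⟨by omega⟩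
  have hfr := FiniteField.finrank_extension F p (2 * k)
  haveI : Fintype (FiniteField.Extension F p (2 * k)) := Fintype.ofFinite _
  have := wkK_bound (L := FiniteField.Extension F p (2 * k)) ψ hψ hodd k hk hfr a b ha hb
  rw [wkK_eq ψ a b {P ∈ wkIrr F (2 * k) | P.natDegree ∣ 2 * k}] at this
  · rw [hfr] at this
    exact this
  · intro P
    rw [Finset.mem_filter, mem_wkIrr, hfr]
    constructor
    · rintro ⟨⟨h1, h2, h3⟩, h4⟩
      exact ⟨h1, h2, h4⟩
    · rintro ⟨h1, h2, h4⟩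
      exact ⟨⟨h1, h2, Nat.le_of_dvd (by omega) h4⟩, h4⟩

end


section
variable {F : Type*} [Field F] [Fintype F]

theorem wk_real (ψ : AddChar F ℂ) (a b : F) : ∃ k : ℝ, wkS ψ a b 1 = (k : ℂ) := by
  classical
  have : starRingEnd ℂ (wkS ψ a b 1) = wkS ψ a b 1 := by
    rw [wkS_one, map_sum]
    refine Fintype.sum_equiv (Equiv.neg F) _ _ fun x => ?_
    by_cases hx : x = 0
    · simp [hx]
    · simp only [Equiv.neg_apply, neg_eq_zero, if_neg hx]
      rw [← AddChar.map_neg_eq_conj]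
      congr 1
      rw [inv_neg]
      ring
  obtain ⟨k, hk⟩ := Complex.conj_eq_iff_real.1 this
  exact ⟨k, hk⟩

theorem wk_kloosterman (ψ : AddChar F ℂ) (hψ : ψ ≠ 1) (hodd : Odd (Fintype.card F))
    (a b : F) (ha : a ≠ 0) (hb : b ≠ 0) :
    ‖wkS ψ a b 1‖ ≤ 2 * √(Fintype.card F : ℝ) := by
  obtain ⟨k, hk⟩ := wk_real ψ a b
  set q : ℝ := (Fintype.card F : ℝ) with hq
  have hqpos : 0 < q := by rw [hq]; exact_mod_cast Fintype.card_pos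
  rw [hk, Complex.norm_real, Real.norm_eq_abs]
  by_contra hcon
  push Not at hcon
  have hs : √q ^ 2 = q := Real.sq_sqrt hqpos.le
  have hs0 : 0 ≤ √q := Real.sqrt_nonneg q
  have hk2 : 4 * q < k ^ 2 := by
    rw [← sq_abs k]
    nlinarith
  obtain ⟨α, hα, hα2⟩ : ∃ α : ℝ, α ^ 2 + k * α + q = 0 ∧ q < α ^ 2 := by
    set D := √(k ^ 2 - 4 * q) with hD
    have hD0 : 0 < D := Real.sqrt_pos.2 (by linarith)
    have hD2 : D ^ 2 = k ^ 2 - 4 * q := Real.sq_sqrt (by linarith)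
    rcases le_total 0 k with h | h
    · refine ⟨(-k - D) / 2, by nlinarith, by nlinarith [mul_nonneg h hD0.le]⟩
    · refine ⟨(-k + D) / 2, by nlinarith, by nlinarith [mul_nonneg (neg_nonneg.2 h) hD0.le]⟩
  have hα0 : α ≠ 0 := by
    rintro rfl
    nlinarith
  set β := -k - α with hβ
  have hab : α * β = q := by rw [hβ]; nlinarith
  have S0 := wkS_zero ψ a b
  have S2 : wkS ψ a b 2 = (q : ℂ) := by
    rw [wkS_two ψ hψ a b ha hb, hq]; simp
  have Sge := wkS_ge ψ hψ a b ha
  have P1 : wkP ψ a b 1 = (k : ℂ) := by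
    have := wk_newton ψ a b 1
    simp [S0, hk] at this
    exact this.symm
  have P2 : wkP ψ a b 2 = 2 * (q : ℂ) - (k : ℂ) ^ 2 := by
    have := wk_newton ψ a b 2
    rw [Finset.sum_Icc_succ_top (by norm_num)] at this
    simp [S0, hk, S2, P1] at this
    linear_combination -this
  have Prec : ∀ n, wkP ψ a b (n + 3) = - (k : ℂ) * wkP ψ a b (n + 2) - q * wkP ψ a b (n + 1) := by
    intro n
    have := wk_newton ψ a b (n + 3)
    rw [Finset.sum_Icc_succ_top (by omega), Finset.sum_Icc_succ_top (by omega),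
      Finset.sum_Icc_succ_top (by omega), Finset.sum_eq_zero] at this
    · rw [Sge (n + 3) (by omega)] at this
      have e1 : n + 3 - (n + 1) = 2 := by omega
      have e2 : n + 3 - (n + 1 + 1) = 1 := by omega
      have e3 : n + 3 - (n + 2 + 1) = 0 := by omega
      rw [e1, e2, e3, S0, S2, hk] at this
      have e4 : n + 1 + 1 = n + 2 := rfl
      have e5 : n + 2 + 1 = n + 3 := rfl
      rw [e4, e5] at this
      linear_combination -this
    · intro j hj
      rw [Finset.mem_Icc] at hj
      rw [Sge _ (by omega), mul_zero]
  have main : ∀ n, wkP ψ a b (n + 1) = ((-(α ^ (n + 1) + β ^ (n + 1)) : ℝ) : ℂ) ∧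
      wkP ψ a b (n + 2) = ((-(α ^ (n + 2) + β ^ (n + 2)) : ℝ) : ℂ) := by
    intro n
    induction n with
    | zero =>
      refine ⟨?_, ?_⟩
      · rw [P1]; congr 1; rw [hβ]; ring
      · rw [P2]
        have : (2 * (q : ℂ) - (k : ℂ) ^ 2) = ((2 * q - k ^ 2 : ℝ) : ℂ) := by push_cast; ring
        rw [this]
        congr 1
        have : k = - α - β := by rw [hβ]; ring
        rw [this, ← hab]; ring
    | succ n ih =>
      refine ⟨ih.2, ?_⟩
      rw [show n + 1 + 2 = n + 3 from rfl, Prec, ih.1, ih.2, ← Complex.ofReal_neg,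
        ← Complex.ofReal_mul, ← Complex.ofReal_mul, ← Complex.ofReal_sub]
      congr 1
      have : k = - α - β := by rw [hβ]; ring
      rw [this, ← hab]; ring
  have hb' : ∀ m, 3 ≤ m → (α ^ 2 / q) ^ m ≤ 11 * q := by
    intro m hm
    have h1 := wkP_bound ψ hψ hodd m hm a b ha hb
    obtain ⟨r, hr⟩ : ∃ r, 2 * m = r + 1 := ⟨2 * m - 1, by omega⟩
    have h2 := (main r).1
    rw [← hr] at h2
    rw [h2, Complex.norm_real, Real.norm_eq_abs, abs_neg, pow_mul, pow_mul] at h1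
    have h3 := le_abs_self ((α ^ 2) ^ m + (β ^ 2) ^ m)
    have h4 : 0 ≤ (β ^ 2) ^ m := by positivity
    rw [div_pow, div_le_iff₀ (by positivity)]
    linarith
  obtain ⟨m, hm⟩ := pow_unbounded_of_one_lt (11 * q) ((one_lt_div hqpos).2 hα2)
  have h1 := hb' (m + 3) (by omega)
  have h2 : (α ^ 2 / q) ^ m ≤ (α ^ 2 / q) ^ (m + 3) :=
    pow_le_pow_right₀ ((one_lt_div hqpos).2 hα2).le (by omega)
  linarith

open Classical in
theorem wk_kloosterman' (ψ : AddChar F ℂ) (hψ : ψ ≠ 1) (hodd : Odd (Fintype.card F))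
    (a b : F) (ha : a ≠ 0) (hb : b ≠ 0) :
    ‖∑ x : F, if x = 0 then 0 else ψ (a * x + b * x⁻¹)‖ ≤ 2 * √(Fintype.card F : ℝ) := by
  have := wk_kloosterman ψ hψ hodd a b ha hb
  rwa [wkS_one] at this

end


section
variable {F : Type*} [Field F] [Fintype F]

theorem wk_map_sum {ι : Type*} (ψ : AddChar F ℂ) (s : Finset ι) (f : ι → F) :
    ψ (∑ i ∈ s, f i) = ∏ i ∈ s, ψ (f i) := by
  classical
  induction s using Finset.induction_on with
  | empty => simp
  | insert i s hi ih => rw [Finset.sum_insert hi, Finset.prod_insert hi, AddChar.map_add_eq_mul, ih]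

theorem wk_sum_pi {ι : Type*} [Fintype ι] [DecidableEq ι] (g : ι → F → ℂ) :
    ∑ z : ι → F, ∏ i, g i (z i) = ∏ i, ∑ x : F, g i x := by
  rw [Finset.prod_univ_sum, Fintype.piFinset_univ]

theorem wk_orth1 [DecidableEq F] (ψ : AddChar F ℂ) (hψ : ψ.IsPrimitive) (c : F) :
    ∑ s : F, ψ (c * s) = if c = 0 then (Fintype.card F : ℂ) else 0 := by
  have := AddChar.sum_mulShift c hψ
  simp only [mul_comm c]
  rw [this]
  split_ifs <;> simp

theorem wk_orth [DecidableEq F] {ι : Type*} [Fintype ι] [DecidableEq ι] (ψ : AddChar F ℂ)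
    (hψ : ψ.IsPrimitive) (z : ι → F) :
    ∑ ξ : ι → F, ψ (∑ i, z i * ξ i) =
      if z = 0 then (Fintype.card F : ℂ) ^ Fintype.card ι else 0 := by
  simp only [wk_map_sum]
  rw [wk_sum_pi (fun i x => ψ (z i * x))]
  simp only [wk_orth1 ψ hψ]
  split_ifs with h
  · subst h
    simp
  · obtain ⟨i, hi⟩ := Function.ne_iff.1 h
    apply Finset.prod_eq_zero (Finset.mem_univ i)
    rw [if_neg (by simpa using hi)]

/-- quadratic character with complex values -/
noncomputable def wkChi (F : Type*) [Field F] [Fintype F] [DecidableEq F] : MulChar F ℂ :=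
  (quadraticChar F).ringHomComp (Int.castRingHom ℂ)

theorem wkChi_apply [DecidableEq F] (x : F) : wkChi F x = ((quadraticChar F x : ℤ) : ℂ) := rfl

theorem wkChi_quad [DecidableEq F] : (wkChi F).IsQuadratic :=
  (quadraticChar_isQuadratic F).comp _

theorem wkChi_ne [DecidableEq F] (h2 : ringChar F ≠ 2) : wkChi F ≠ 1 := by
  intro h
  apply quadraticChar_ne_one h2
  apply MulChar.injective_ringHomComp (f := Int.castRingHom ℂ) Int.cast_injective
  exact h.trans (MulChar.ringHomComp_one _).symm

theorem wkChi_sq [DecidableEq F] (x : F) (hx : x ≠ 0) : wkChi F x ^ 2 = 1 := by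
  rw [wkChi_apply]
  exact_mod_cast quadraticChar_sq_one hx

theorem wkChi_norm [DecidableEq F] (x : F) (hx : x ≠ 0) : ‖wkChi F x‖ = 1 := by
  have h := congrArg norm (wkChi_sq x hx)
  rw [norm_pow, norm_one] at h
  exact (pow_eq_one_iff_of_nonneg (norm_nonneg _) two_ne_zero).1 h

theorem wk_gauss_norm [DecidableEq F] (h2 : ringChar F ≠ 2) (ψ : AddChar F ℂ)
    (hψ : ψ.IsPrimitive) : ‖gaussSum (wkChi F) ψ‖ = √(Fintype.card F : ℝ) := by
  have h := gaussSum_mul_gaussSum_eq_card (wkChi_ne h2) hψ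
  rw [← star_gaussSum_eq] at h
  have h' := congrArg norm h
  rw [norm_mul, norm_star, Complex.norm_natCast] at h'
  rw [← h', Real.sqrt_mul_self (norm_nonneg _)]

theorem wk_gauss1 [DecidableEq F] (h2 : ringChar F ≠ 2) (ψ : AddChar F ℂ)
    (hψ : ψ.IsPrimitive) (A : F) (hA : A ≠ 0) :
    ∑ z : F, ψ (A * z ^ 2) = wkChi F A * gaussSum (wkChi F) ψ := by
  have h1 : ∑ z : F, ψ (A * z ^ 2) = ∑ u : F, (wkChi F u + 1) * ψ (A * u) := by
    rw [← Finset.sum_fiberwise (s := Finset.univ) (g := fun z : F => z ^ 2)]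
    refine Finset.sum_congr rfl fun u _ => ?_
    rw [Finset.sum_congr rfl (g := fun _ => ψ (A * u))]
    · rw [Finset.sum_const, nsmul_eq_mul]
      congr 1
      have := quadraticChar_card_sqrts h2 u
      rw [wkChi_apply]
      have e : ({x : F | x ^ 2 = u}.toFinset) = Finset.univ.filter (fun x : F => x ^ 2 = u) := by
        ext; simp
      rw [e] at this
      exact_mod_cast this
    · intro z hz
      rw [(Finset.mem_filter.1 hz).2]
  rw [h1]
  simp only [add_mul, one_mul, Finset.sum_add_distrib]
  rw [wk_orth1 ψ hψ, if_neg hA, add_zero]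
  have h3 := gaussSum_mulShift_eq (wkChi F) ψ (Units.mk0 A hA)
  rw [wkChi_quad.inv] at h3
  rw [Units.val_mk0] at h3
  rw [← h3]
  simp [gaussSum, AddChar.mulShift_apply]

theorem wk_two_ne (h2 : ringChar F ≠ 2) : (2 : F) ≠ 0 := Ring.two_ne_zero h2

theorem wk_gauss2 [DecidableEq F] (h2 : ringChar F ≠ 2) (ψ : AddChar F ℂ)
    (hψ : ψ.IsPrimitive) (A B : F) (hA : A ≠ 0) :
    ∑ z : F, ψ (A * z ^ 2 + z * B) = ψ (-(B ^ 2 / (4 * A))) *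
      (wkChi F A * gaussSum (wkChi F) ψ) := by
  have h20 := wk_two_ne h2
  have h40 : (4 : F) ≠ 0 := by
    have : (4 : F) = 2 * 2 := by norm_num
    rw [this]; exact mul_ne_zero h20 h20
  rw [← wk_gauss1 h2 ψ hψ A hA, Finset.mul_sum]
  refine Fintype.sum_equiv (Equiv.addRight (B / (2 * A))) _ _ fun z => ?_
  rw [← AddChar.map_add_eq_mul]
  congr 1
  simp only [Equiv.coe_addRight]
  have : (4 : F) = 2 * 2 := by norm_num
  rw [this]
  field_simp
  ring

open Classical in
theorem wk_bhat {ι : Type*} [Fintype ι] (h2 : ringChar F ≠ 2) (ψ : AddChar F ℂ)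
    (hψ : ψ.IsPrimitive) (c : ι → F) (hc : ∀ i, c i ≠ 0) (t : F) (ξ : ι → F) :
    ∑ z : ι → F, ((if ∑ i, c i * z i ^ 2 = t then (1 : ℂ) else 0) - 1 / (Fintype.card F : ℂ)) *
      ψ (∑ i, z i * ξ i) =
    (1 / (Fintype.card F : ℂ)) * ((∏ i, wkChi F (c i)) * gaussSum (wkChi F) ψ ^ Fintype.card ι *
      ∑ s : F, if s = 0 then 0 else wkChi F s ^ Fintype.card ι *
        ψ ((-t) * s + (-∑ i, ξ i ^ 2 / (4 * c i)) * s⁻¹)) := by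
  have hq0 : (Fintype.card F : ℂ) ≠ 0 := by exact_mod_cast Fintype.card_ne_zero
  have hind : ∀ u : F, (if u = t then (1 : ℂ) else 0) - 1 / (Fintype.card F : ℂ) =
      (1 / (Fintype.card F : ℂ)) * ∑ s : F, if s = 0 then 0 else ψ (s * (u - t)) := by
    intro u
    have h1 := wk_orth1 ψ hψ (u - t)
    have h3 : ∑ s : F, (if s = 0 then 0 else ψ (s * (u - t))) =
        (∑ s : F, ψ ((u - t) * s)) - 1 := by
      rw [eq_sub_iff_add_eq, ← Finset.sum_erase_add _ _ (Finset.mem_univ (0 : F)),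
        ← Finset.sum_erase_add (Finset.univ) (fun s => ψ ((u - t) * s)) (Finset.mem_univ (0 : F))]
      simp only [if_true, add_zero, mul_zero, AddChar.map_zero_eq_one]
      congr 1
      refine Finset.sum_congr rfl fun s hs => ?_
      rw [if_neg (Finset.ne_of_mem_erase hs), mul_comm]
    rw [h3, h1, sub_eq_zero]
    split_ifs
    · field_simp
    · ring
  simp only [hind, mul_assoc, Finset.sum_mul]
  rw [← Finset.mul_sum, Finset.sum_comm]
  congr 1
  rw [Finset.mul_sum, Finset.mul_sum]
  refine Finset.sum_congr rfl fun s _ => ?_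
  by_cases hs : s = 0
  · simp [hs]
  simp only [if_neg hs]
  have h3 : ∀ z : ι → F, ψ (s * (∑ i, c i * z i ^ 2 - t)) * ψ (∑ i, z i * ξ i) =
      ψ (-t * s) * ∏ i, ψ (s * c i * z i ^ 2 + z i * ξ i) := by
    intro z
    rw [← wk_map_sum, ← AddChar.map_add_eq_mul, ← AddChar.map_add_eq_mul]
    congr 1
    rw [Finset.sum_add_distrib, mul_sub, Finset.mul_sum]
    simp only [mul_assoc]
    ring
  simp only [h3]
  rw [← Finset.mul_sum, wk_sum_pi (fun i x => ψ (s * c i * x ^ 2 + x * ξ i))]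
  have h4 : ∀ i, ∑ x : F, ψ (s * c i * x ^ 2 + x * ξ i) = ψ (-(ξ i ^ 2 / (4 * c i)) * s⁻¹) *
      (wkChi F s * wkChi F (c i) * gaussSum (wkChi F) ψ) := by
    intro i
    rw [wk_gauss2 h2 ψ hψ _ _ (mul_ne_zero hs (hc i)), map_mul]
    congr 2
    rw [← div_eq_mul_inv, neg_div, div_div]
    congr 2
    ring
  simp only [h4]
  rw [Finset.prod_mul_distrib, Finset.prod_mul_distrib, Finset.prod_mul_distrib, ← wk_map_sum,
    Finset.prod_const, Finset.prod_const, Finset.card_univ, AddChar.map_add_eq_mul,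
    ← Finset.sum_mul, Finset.sum_neg_distrib]
  ring

end


section
variable {F : Type*} [Field F] [Fintype F]

open Classical in
theorem wk_salie (h2 : ringChar F ≠ 2) (ψ : AddChar F ℂ) (hψ : ψ.IsPrimitive) (a b : F)
    (ha : a ≠ 0) :
    ‖∑ s : F, if s = 0 then 0 else wkChi F s * ψ (a * s + b * s⁻¹)‖ ≤
      2 * √(Fintype.card F : ℝ) := by
  have hG := wk_gauss_norm h2 ψ hψ
  have hs0 : 0 < √(Fintype.card F : ℝ) := Real.sqrt_pos.2 (by exact_mod_cast Fintype.card_pos)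
  have hsq : √(Fintype.card F : ℝ) * √(Fintype.card F : ℝ) = (Fintype.card F : ℝ) :=
    Real.mul_self_sqrt (by positivity)
  by_cases hb : b = 0
  · subst hb
    have h1 : (∑ s : F, if s = 0 then 0 else wkChi F s * ψ (a * s + 0 * s⁻¹)) =
        wkChi F a * gaussSum (wkChi F) ψ := by
      have h3 := gaussSum_mulShift_eq (wkChi F) ψ (Units.mk0 a ha)
      rw [wkChi_quad.inv, Units.val_mk0] at h3
      rw [← h3, gaussSum]
      refine Finset.sum_congr rfl fun s _ => ?_
      by_cases hs : s = 0
      · rw [if_pos hs, hs, MulChar.map_zero, zero_mul]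
      · simp [hs, AddChar.mulShift_apply]
    rw [h1, norm_mul, wkChi_norm a ha, hG]
    linarith
  · have h20 := wk_two_ne h2
    have h40 : (4 : F) ≠ 0 := by
      have : (4 : F) = 2 * 2 := by norm_num
      rw [this]; exact mul_ne_zero h20 h20
    set c : F := -1 / (4 * b) with hc
    have hc0 : c ≠ 0 := by
      rw [hc]
      exact div_ne_zero (by simp) (mul_ne_zero h40 hb)
    have h1 := wk_bhat (ι := Fin 1) h2 ψ hψ (fun _ => c) (fun _ => hc0) (-a) (fun _ => 1)
    have hb' : -((1 : F) ^ 2 / (4 * c)) = b := by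
      rw [hc]; field_simp
    simp only [Finset.univ_unique, Finset.sum_singleton, Finset.prod_singleton, Fintype.card_unique,
      pow_one, neg_neg, hb'] at h1
    have h3 : ‖∑ z : Fin 1 → F, ((if c * z default ^ 2 = -a then (1 : ℂ) else 0) -
        1 / (Fintype.card F : ℂ)) * ψ (z default * 1)‖ ≤ 2 := by
      have e1 : ∑ z : Fin 1 → F, ((if c * z default ^ 2 = -a then (1 : ℂ) else 0) -
        1 / (Fintype.card F : ℂ)) * ψ (z default * 1) = ∑ x : F, ((if c * x ^ 2 = -a then
          (1 : ℂ) else 0) - 1 / (Fintype.card F : ℂ)) * ψ (x * 1) :=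
        Fintype.sum_equiv (Equiv.funUnique (Fin 1) F) _ _ fun z => rfl
      rw [e1]
      simp only [sub_mul, Finset.sum_sub_distrib]
      rw [← Finset.mul_sum]
      have e2 : ∑ x : F, ψ (x * 1) = 0 := by
        have := wk_orth1 ψ hψ 1
        simpa using this
      rw [e2, mul_zero, sub_zero]
      refine (norm_sum_le _ _).trans ?_
      have e3 : ∀ x : F, ‖(if c * x ^ 2 = -a then (1 : ℂ) else 0) * ψ (x * 1)‖ =
          if x ^ 2 = -a / c then (1 : ℝ) else 0 := by
        intro x
        have : c * x ^ 2 = -a ↔ x ^ 2 = -a / c := by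
          rw [eq_div_iff hc0, mul_comm]
        simp only [this, norm_mul, AddChar.norm_apply, mul_one]
        split_ifs <;> simp
      simp only [e3]
      rw [Finset.sum_boole]
      have := quadraticChar_card_sqrts h2 (-a / c)
      have e : ({x : F | x ^ 2 = -a / c}.toFinset) =
          Finset.univ.filter (fun x : F => x ^ 2 = -a / c) := by
        ext; simp
      rw [e] at this
      have h5 : quadraticChar F (-a / c) = 1 ∨ quadraticChar F (-a / c) = -1 :=
        quadraticChar_dichotomy (div_ne_zero (neg_ne_zero.2 ha) hc0)
      have h6 : (Finset.univ.filter (fun x : F => x ^ 2 = -a / c)).card ≤ 2 := by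
        rcases h5 with h5 | h5 <;> rw [h5] at this <;> omega
      exact_mod_cast h6
    replace h3 := le_of_eq_of_le (congrArg norm h1).symm (le_of_eq_of_le (by congr!) h3)
    rw [norm_mul, norm_mul, norm_mul, wkChi_norm c hc0, hG, norm_div, norm_one,
      Complex.norm_natCast, one_mul] at h3
    set S := ‖∑ s : F, if s = 0 then 0 else wkChi F s * ψ (a * s + b * s⁻¹)‖ with hS
    have h7 : 1 / (Fintype.card F : ℝ) * (√(Fintype.card F : ℝ) * S) =
        S / √(Fintype.card F : ℝ) := by
      have e8 : 1 / (Fintype.card F : ℝ) = 1 / (√(Fintype.card F : ℝ) * √(Fintype.card F : ℝ)) := by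
        rw [hsq]
      rw [e8]
      field_simp
    rw [h7, div_le_iff₀ hs0] at h3
    exact h3

open Classical in
theorem wk_bhat_bound {ι : Type*} [Fintype ι] (hodd : Odd (Fintype.card F)) (h2 : ringChar F ≠ 2)
    (ψ : AddChar F ℂ) (hψ : ψ.IsPrimitive) (hψ1 : ψ ≠ 1) (c : ι → F) (hc : ∀ i, c i ≠ 0)
    (t : F) (ht : t ≠ 0) (ξ : ι → F) :
    ‖∑ z : ι → F, ((if ∑ i, c i * z i ^ 2 = t then (1 : ℂ) else 0) - 1 / (Fintype.card F : ℂ)) *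
      ψ (∑ i, z i * ξ i)‖ ≤
    (1 / (Fintype.card F : ℝ)) * (√(Fintype.card F : ℝ) ^ Fintype.card ι *
      (2 * √(Fintype.card F : ℝ))) := by
  have hG := wk_gauss_norm h2 ψ hψ
  rw [wk_bhat h2 ψ hψ c hc t ξ, norm_mul, norm_mul, norm_mul, norm_div, norm_one,
      Complex.norm_natCast, norm_pow, hG, norm_prod]
  simp only [wkChi_norm _ (hc _)]
  rw [Finset.prod_const_one, one_mul]
  refine mul_le_mul_of_nonneg_left (mul_le_mul_of_nonneg_left ?_ (by positivity)) (by positivity)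
  set N := -∑ i, ξ i ^ 2 / (4 * c i) with hN
  rcases Nat.even_or_odd (Fintype.card ι) with he | ho
  · have h1 : ∀ s : F, (if s = 0 then 0 else wkChi F s ^ Fintype.card ι * ψ (-t * s + N * s⁻¹)) =
        if s = 0 then 0 else ψ (-t * s + N * s⁻¹) := by
      intro s
      split_ifs with hs
      · rfl
      · obtain ⟨m, hm⟩ := he
        rw [hm, ← two_mul, pow_mul, wkChi_sq s hs, one_pow, one_mul]
    simp only [h1]
    by_cases hN0 : N = 0
    · rw [hN0]
      have h3 : ∑ s : F, (if s = 0 then 0 else ψ (-t * s + 0 * s⁻¹)) = -1 := by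
        have h4 := wk_orth1 ψ hψ (-t)
        rw [if_neg (neg_ne_zero.2 ht),
          ← Finset.sum_erase_add (Finset.univ) _ (Finset.mem_univ (0 : F))] at h4
        rw [← Finset.sum_erase_add _ _ (Finset.mem_univ (0 : F))]
        simp only [mul_zero, AddChar.map_zero_eq_one] at h4
        rw [if_pos rfl, add_zero, ← add_eq_zero_iff_eq_neg, ← h4]
        congr 1
        refine Finset.sum_congr rfl fun s hs => ?_
        rw [if_neg (Finset.ne_of_mem_erase hs), zero_mul, add_zero]
      rw [h3, norm_neg, norm_one]
      have : 1 ≤ √(Fintype.card F : ℝ) := by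
        rw [Real.one_le_sqrt]
        exact_mod_cast Fintype.card_pos
      linarith
    · exact wk_kloosterman' ψ hψ1 hodd (-t) N (neg_ne_zero.2 ht) hN0
  · have h1 : ∀ s : F, (if s = 0 then 0 else wkChi F s ^ Fintype.card ι * ψ (-t * s + N * s⁻¹)) =
        if s = 0 then 0 else wkChi F s * ψ (-t * s + N * s⁻¹) := by
      intro s
      split_ifs with hs
      · rfl
      · obtain ⟨m, hm⟩ := ho
        rw [hm, pow_succ, pow_mul, wkChi_sq s hs, one_pow, one_mul]
    simp only [h1]
    exact wk_salie h2 ψ hψ (-t) N (neg_ne_zero.2 ht)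

theorem wk_fourier_id {ι : Type*} [Fintype ι] [DecidableEq ι] (ψ : AddChar F ℂ)
    (hψ : ψ.IsPrimitive) (b : (ι → F) → ℂ) (f : (ι → F) → ℝ) :
    ∑ ξ : ι → F, (∑ z, b z * ψ (∑ i, z i * ξ i)) *
      ((starRingEnd ℂ) (∑ x, (f x : ℂ) * ψ (∑ i, x i * ξ i)) *
        (∑ y, (f y : ℂ) * ψ (∑ i, y i * ξ i))) =
      (Fintype.card F : ℂ) ^ Fintype.card ι * ∑ x, ∑ y, (f x : ℂ) * f y * b (x - y) := by
  classical
  have h1 : ∀ ξ : ι → F, (∑ z, b z * ψ (∑ i, z i * ξ i)) *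
      ((starRingEnd ℂ) (∑ x, (f x : ℂ) * ψ (∑ i, x i * ξ i)) *
        (∑ y, (f y : ℂ) * ψ (∑ i, y i * ξ i))) =
      ∑ x, ∑ y, ∑ z, (f x : ℂ) * f y * b z * ψ (∑ i, (z - (x - y)) i * ξ i) := by
    intro ξ
    rw [map_sum, Finset.sum_mul_sum, mul_comm, Finset.sum_mul]
    refine Finset.sum_congr rfl fun x _ => ?_
    rw [Finset.sum_mul]
    refine Finset.sum_congr rfl fun y _ => ?_
    rw [Finset.mul_sum]
    refine Finset.sum_congr rfl fun z _ => ?_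
    rw [map_mul, Complex.conj_ofReal, ← AddChar.map_neg_eq_conj]
    have : ψ (∑ i, (z - (x - y)) i * ξ i) = ψ (-∑ i, x i * ξ i) * ψ (∑ i, y i * ξ i) *
        ψ (∑ i, z i * ξ i) := by
      rw [← AddChar.map_add_eq_mul, ← AddChar.map_add_eq_mul]
      congr 1
      rw [← Finset.sum_neg_distrib, ← Finset.sum_add_distrib, ← Finset.sum_add_distrib]
      refine Finset.sum_congr rfl fun i _ => ?_
      simp only [Pi.sub_apply]
      ring
    rw [this]
    ring
  simp only [h1]
  rw [Finset.sum_comm, Finset.mul_sum]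
  refine Finset.sum_congr rfl fun x _ => ?_
  rw [Finset.sum_comm, Finset.mul_sum]
  refine Finset.sum_congr rfl fun y _ => ?_
  rw [Finset.sum_comm]
  have h3 : ∀ z : ι → F, ∑ ξ : ι → F, (f x : ℂ) * f y * b z * ψ (∑ i, (z - (x - y)) i * ξ i) =
      if z = x - y then (Fintype.card F : ℂ) ^ Fintype.card ι * ((f x : ℂ) * f y * b (x - y))
        else 0 := by
    intro z
    rw [← Finset.mul_sum, wk_orth ψ hψ]
    simp only [sub_eq_zero]
    split_ifs with h
    · rw [h]; ring
    · simp
  simp only [h3]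
  rw [Finset.sum_ite_eq' Finset.univ (x - y), if_pos (Finset.mem_univ _)]

theorem wk_fourier {ι : Type*} [Fintype ι] [DecidableEq ι] (ψ : AddChar F ℂ)
    (hψ : ψ.IsPrimitive) (b : (ι → F) → ℂ) (f : (ι → F) → ℝ) (B : ℝ)
    (hB : ∀ ξ : ι → F, ‖∑ z, b z * ψ (∑ i, z i * ξ i)‖ ≤ B) :
    ‖∑ x, ∑ y, (f x : ℂ) * f y * b (x - y)‖ ≤ B * ∑ x, f x ^ 2 := by
  classical
  have hq0 : 0 < (Fintype.card F : ℝ) := by exact_mod_cast Fintype.card_pos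
  have h1 := wk_fourier_id ψ hψ b f
  have h2 := wk_fourier_id ψ hψ (fun z : ι → F => if z = 0 then 1 else 0) f
  have h3 : ∑ x, ∑ y, (f x : ℂ) * f y * (if x - y = 0 then 1 else 0) =
      ((∑ x, f x ^ 2 : ℝ) : ℂ) := by
    push_cast
    refine Finset.sum_congr rfl fun x _ => ?_
    simp only [sub_eq_zero]
    simp
    ring
  have h4 : ∀ ξ : ι → F, ∑ z : ι → F, (if z = 0 then (1 : ℂ) else 0) * ψ (∑ i, z i * ξ i) = 1 := by
    intro ξ
    simp
  simp only [h4, one_mul] at h2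
  rw [h3] at h2
  set fh : (ι → F) → ℂ := fun ξ => ∑ x, (f x : ℂ) * ψ (∑ i, x i * ξ i) with hfh
  have h5 : ∀ ξ, (starRingEnd ℂ) (fh ξ) * fh ξ = ((‖fh ξ‖ ^ 2 : ℝ) : ℂ) := by
    intro ξ
    rw [Complex.conj_mul']
    push_cast; rfl
  have h6 : ∑ ξ, ‖fh ξ‖ ^ 2 = (Fintype.card F : ℝ) ^ Fintype.card ι * ∑ x, f x ^ 2 := by
    have h7 : ∑ ξ, (starRingEnd ℂ) (fh ξ) * fh ξ = _ := h2
    simp only [h5] at h7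
    exact_mod_cast h7
  have h8 : (Fintype.card F : ℝ) ^ Fintype.card ι * ‖∑ x, ∑ y, (f x : ℂ) * f y * b (x - y)‖ ≤
      (Fintype.card F : ℝ) ^ Fintype.card ι * (B * ∑ x, f x ^ 2) := by
    have e : (Fintype.card F : ℝ) ^ Fintype.card ι * ‖∑ x, ∑ y, (f x : ℂ) * f y * b (x - y)‖ =
      ‖(Fintype.card F : ℂ) ^ Fintype.card ι * ∑ x, ∑ y, (f x : ℂ) * f y * b (x - y)‖ := by
      rw [norm_mul, norm_pow, Complex.norm_natCast]
    rw [e, ← h1]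
    calc _ ≤ ∑ ξ, B * ‖fh ξ‖ ^ 2 := by
          refine (norm_sum_le _ _).trans (Finset.sum_le_sum fun ξ _ => ?_)
          rw [norm_mul]
          refine mul_le_mul (hB ξ) ?_ (norm_nonneg _) ((norm_nonneg _).trans (hB ξ))
          have := congrArg norm (h5 ξ)
          rw [Complex.norm_real, Real.norm_of_nonneg (by positivity)] at this
          exact this.le
      _ = _ := by
          rw [← Finset.mul_sum, h6]; ring
  exact le_of_mul_le_mul_left h8 (by positivity)

end


section
variable {F : Type*} [Field F] [Fintype F]

theorem wk_diag (d : ℕ) (h20 : (2 : F) ≠ 0)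
    (Q : QuadraticForm F (Fin d → F))
    (hQ : ∀ x, (∀ y, QuadraticMap.polar (⇑Q) x y = 0) → x = 0) :
    ∃ (w : Fin d → F) (e : (Fin d → F) ≃ₗ[F] (Fin d → F)), (∀ i, w i ≠ 0) ∧
      ∀ z, Q z = ∑ i, w i * (e z) i ^ 2 := by
  have hinv : Invertible (2 : F) := invertibleOfNonzero h20
  have hsep : (QuadraticMap.associated (R := F) Q).SeparatingLeft := by
    intro x hx
    apply hQ
    intro y
    have h3 := QuadraticMap.two_nsmul_associated F Q
    have h4 := LinearMap.congr_fun (LinearMap.congr_fun h3 x) y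
    rw [QuadraticMap.polarBilin_apply_apply] at h4
    rw [← h4]
    have h5 := hx y
    simp only [LinearMap.smul_apply]
    rw [h5, smul_zero]
  have h6 := QuadraticForm.equivalent_weightedSumSquares_units_of_nondegenerate' Q hsep
  rw [Module.finrank_fin_fun] at h6
  obtain ⟨w, ⟨e⟩⟩ := h6
  refine ⟨fun i => (w i : F), e.toLinearEquiv, fun i => (w i).ne_zero, fun z => ?_⟩
  rw [← e.map_app z, QuadraticMap.weightedSumSquares_apply]
  refine Finset.sum_congr rfl fun i _ => ?_
  rw [Units.smul_def, smul_eq_mul, sq]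
  rfl

open Classical in
theorem wk_form_bound (d : ℕ) (hodd : Odd (Fintype.card F))
    (Q : QuadraticForm F (Fin d → F))
    (hQ : ∀ x, (∀ y, QuadraticMap.polar (⇑Q) x y = 0) → x = 0)
    (t : F) (ht : t ≠ 0) (f : (Fin d → F) → ℝ) :
    |∑ x, ∑ y, f x * f y * ((if Q (x - y) = t then (1 : ℝ) else 0) - 1 / (Fintype.card F : ℝ))| ≤
    (1 / (Fintype.card F : ℝ)) * (√(Fintype.card F : ℝ) ^ d *
      (2 * √(Fintype.card F : ℝ))) * ∑ x, f x ^ 2 := by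
  have h2 : ringChar F ≠ 2 := by
    intro h
    have := FiniteField.even_card_of_char_two h
    rw [Nat.odd_iff] at hodd
    omega
  have h20 : (2 : F) ≠ 0 := wk_two_ne h2
  obtain ⟨w, e, hw, hQe⟩ := wk_diag d h20 Q hQ
  obtain ⟨ψ, hψ⟩ : ∃ ψ : AddChar F ℂ, ψ.IsPrimitive :=
    ⟨_, AddChar.FiniteField.primitiveChar_to_Complex_isPrimitive F⟩
  have hψ1 : ψ ≠ 1 := by
    have := hψ one_ne_zero
    rwa [AddChar.mulShift_one] at this
  have hbound := wk_bhat_bound hodd h2 ψ hψ hψ1 w hw t ht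
  rw [Fintype.card_fin] at hbound
  have hF := wk_fourier ψ hψ
    (fun z => (if ∑ i, w i * z i ^ 2 = t then (1 : ℂ) else 0) - 1 / (Fintype.card F : ℂ))
    (fun u => f (e.symm u)) _ (fun ξ => le_of_eq_of_le (by congr!) (hbound ξ))
  have s1 : ∑ x, f x ^ 2 = ∑ u, f (e.symm u) ^ 2 :=
    Fintype.sum_equiv e.toEquiv _ _ fun x => by
      congr 2
      exact (e.symm_apply_apply x).symm
  rw [s1]
  refine le_of_eq_of_le ?_ hF
  rw [← Real.norm_eq_abs, ← Complex.norm_real]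
  congr 1
  push_cast
  refine Fintype.sum_equiv e.toEquiv _ _ fun x => ?_
  refine Fintype.sum_equiv e.toEquiv _ _ fun y => ?_
  have hx : e.symm (e.toEquiv x) = x := e.symm_apply_apply x
  have hy : e.symm (e.toEquiv y) = y := e.symm_apply_apply y
  rw [hx, hy]
  have hz : e.toEquiv x - e.toEquiv y = e (x - y) :=
    (map_sub e x y).symm
  rw [hz, hQe (x - y)]
  split_ifs <;> simp

end


section
open Matrix

theorem wk_eig {ι : Type*} [Fintype ι] [DecidableEq ι] (M : Matrix ι ι ℝ) (hM : M.IsHermitian) :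
    ∃ (μ : ι → ℝ) (v : ι → ι → ℝ), (∀ i, M *ᵥ v i = μ i • v i) ∧
      (∀ i j, v i ⬝ᵥ v j = if i = j then 1 else 0) ∧
      (∀ f g : ι → ℝ, ∑ i, (f ⬝ᵥ v i) * (v i ⬝ᵥ g) = f ⬝ᵥ g) ∧
      (∀ n : ℕ, (M ^ n).trace = ∑ i, μ i ^ n) := by
  refine ⟨hM.eigenvalues, fun i => (hM.eigenvectorBasis i).ofLp, hM.mulVec_eigenvectorBasis,
    ?_, ?_, ?_⟩
  · intro i j
    have h := orthonormal_iff_ite.1 hM.eigenvectorBasis.orthonormal i j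
    rw [EuclideanSpace.inner_eq_star_dotProduct, star_trivial, dotProduct_comm] at h
    exact h
  · intro f g
    have h := hM.eigenvectorBasis.sum_inner_mul_inner (WithLp.toLp 2 f) (WithLp.toLp 2 g)
    simp only [EuclideanSpace.inner_eq_star_dotProduct, star_trivial] at h
    rw [dotProduct_comm f g, ← h]
    refine Finset.sum_congr rfl fun i _ => ?_
    rw [dotProduct_comm f, dotProduct_comm _ g]
  · intro n
    conv_lhs => rw [hM.spectral_theorem]
    rw [← map_pow, Unitary.conjStarAlgAut_apply, Matrix.trace_mul_cycle]
    rw [Unitary.coe_star_mul_self, one_mul, diagonal_pow, trace_diagonal]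
    simp

theorem wk_spec {ι : Type*} [Fintype ι] [DecidableEq ι] [Nonempty ι] (M : Matrix ι ι ℝ)
    (hM : M.IsHermitian) (h01 : ∀ i j, M i j ^ 2 = M i j) (r L : ℝ) (hr : 0 ≤ r) (hL : 0 ≤ L)
    (hB : ∀ f : ι → ℝ, |f ⬝ᵥ (M *ᵥ f) - r * (∑ i, f i) ^ 2| ≤ L * (f ⬝ᵥ f)) :
    ∃ μ : ℝ, r * Fintype.card ι - L ≤ μ ∧ μ ≤ r * Fintype.card ι + L ∧
      ∀ n : ℕ, 2 ≤ n → |(M ^ n).trace - μ ^ n| ≤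
        L ^ (n - 2) * (Fintype.card ι * (r * Fintype.card ι + L)) := by
  obtain ⟨μ, v, hv, horth, hpars, htr⟩ := wk_eig M hM
  obtain ⟨i0, hi0⟩ := Finite.exists_max μ
  have hN : (0 : ℝ) < Fintype.card ι := by exact_mod_cast Fintype.card_pos
  have hMT : Mᵀ = M := by simpa [Matrix.IsHermitian, conjTranspose_eq_transpose_of_trivial] using hM
  have hone : (1 : ι → ℝ) ⬝ᵥ (1 : ι → ℝ) = Fintype.card ι := by
    simp
  have hqv : ∀ i, v i ⬝ᵥ (M *ᵥ v i) = μ i := by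
    intro i
    rw [hv, dotProduct_smul, horth, if_pos rfl, smul_eq_mul, mul_one]
  -- upper bound
  have hup : ∀ i, μ i ≤ r * Fintype.card ι + L := by
    intro i
    have h1 := (abs_le.1 (hB (v i))).2
    rw [hqv, horth, if_pos rfl] at h1
    have h2 : (∑ x, v i x) ^ 2 ≤ Fintype.card ι := by
      have h3 := sq_sum_le_card_mul_sum_sq (s := (Finset.univ : Finset ι)) (f := v i)
      have h4 : ∑ x, v i x ^ 2 = 1 := by
        have := horth i i
        rw [if_pos rfl] at this
        rw [← this]
        simp [dotProduct, sq]
      rw [h4, mul_one] at h3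
      simpa using h3
    nlinarith [mul_le_mul_of_nonneg_left h2 hr]
  have hlow : ∀ i, -L ≤ μ i := by
    intro i
    have h1 := (abs_le.1 (hB (v i))).1
    rw [hqv, horth, if_pos rfl] at h1
    have : 0 ≤ r * (∑ x, v i x) ^ 2 := by positivity
    linarith
  have hq1 : |(1 : ι → ℝ) ⬝ᵥ (M *ᵥ 1) - r * (Fintype.card ι : ℝ) ^ 2| ≤ L * Fintype.card ι := by
    have := hB 1
    rw [hone] at this
    simpa using this
  have hbig : r * Fintype.card ι - L ≤ μ i0 := by
    have h1 := hpars 1 (M *ᵥ 1)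
    have h2 : ∀ i, v i ⬝ᵥ (M *ᵥ 1) = μ i * (v i ⬝ᵥ 1) := by
      intro i
      rw [dotProduct_mulVec, ← mulVec_transpose, hMT, hv, smul_dotProduct, smul_eq_mul]
    simp only [h2] at h1
    have h3 : (1 : ι → ℝ) ⬝ᵥ (M *ᵥ 1) ≤ μ i0 * Fintype.card ι := by
      rw [← h1, ← hone, ← hpars 1 1, Finset.mul_sum]
      refine Finset.sum_le_sum fun i _ => ?_
      rw [dotProduct_comm 1 (v i)]
      nlinarith [mul_le_mul_of_nonneg_right (hi0 i) (mul_self_nonneg (v i ⬝ᵥ 1))]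
    have h4 := (abs_le.1 hq1).1
    have h5 : (r * Fintype.card ι - L) * Fintype.card ι ≤ μ i0 * Fintype.card ι := by nlinarith
    exact le_of_mul_le_mul_right h5 hN
  have hsmall : ∀ i, i ≠ i0 → μ i ≤ L := by
    intro i hi
    by_contra hcon
    push Not at hcon
    have hcon0 : L < μ i0 := lt_of_lt_of_le hcon (hi0 i)
    obtain ⟨α, β, hab, hz⟩ : ∃ α β : ℝ, 0 < α ^ 2 + β ^ 2 ∧
        α * (∑ x, v i x) + β * (∑ x, v i0 x) = 0 := by
      by_cases h : (∑ x, v i0 x) = 0 ∧ (∑ x, v i x) = 0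
      · exact ⟨1, 0, by norm_num, by rw [h.1, h.2]; ring⟩
      · refine ⟨∑ x, v i0 x, -∑ x, v i x, ?_, by ring⟩
        rw [not_and_or] at h
        rcases h with h | h
        · have := sq_pos_of_ne_zero h
          nlinarith [sq_nonneg (-∑ x, v i x)]
        · have := sq_pos_of_ne_zero h
          nlinarith [sq_nonneg (∑ x, v i0 x)]
    have h1 := (abs_le.1 (hB (α • v i + β • v i0))).2
    have h2 : ∑ x, (α • v i + β • v i0) x = 0 := by
      rw [← hz]
      simp [Finset.sum_add_distrib, Finset.mul_sum]
    have e0 := horth i i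
    have e1 := horth i0 i0
    have e2 := horth i i0
    have e3 := horth i0 i
    rw [if_pos rfl] at e0 e1
    rw [if_neg hi] at e2
    rw [if_neg (Ne.symm hi)] at e3
    have h3 : (α • v i + β • v i0) ⬝ᵥ (α • v i + β • v i0) = α ^ 2 + β ^ 2 := by
      simp only [add_dotProduct, dotProduct_add, smul_dotProduct, dotProduct_smul, smul_eq_mul, e0,
        e1, e2, e3]
      ring
    have h4 : (α • v i + β • v i0) ⬝ᵥ (M *ᵥ (α • v i + β • v i0)) = α ^ 2 * μ i + β ^ 2 * μ i0 := by
      rw [mulVec_add, mulVec_smul, mulVec_smul, hv, hv]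
      simp only [add_dotProduct, dotProduct_add, smul_dotProduct, dotProduct_smul, smul_eq_mul, e0,
        e1, e2, e3]
      ring
    rw [h2, h3, h4] at h1
    have h5 : 0 ≤ α ^ 2 * (μ i - L) := mul_nonneg (sq_nonneg _) (by linarith)
    have h6 : 0 ≤ β ^ 2 * (μ i0 - L) := mul_nonneg (sq_nonneg _) (by linarith)
    have h7 : α ^ 2 * (μ i - L) = 0 := by nlinarith
    have h8 : β ^ 2 * (μ i0 - L) = 0 := by nlinarith
    rcases mul_eq_zero.1 h7 with h | h
    · rcases mul_eq_zero.1 h8 with h' | h'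
      · linarith
      · linarith
    · linarith
  have hsq : ∑ i, μ i ^ 2 ≤ Fintype.card ι * (r * Fintype.card ι + L) := by
    rw [← htr 2]
    have h1 : (M ^ 2).trace = (1 : ι → ℝ) ⬝ᵥ (M *ᵥ 1) := by
      rw [sq, Matrix.trace]
      simp only [Matrix.diag_apply, Matrix.mul_apply, dotProduct, mulVec, Pi.one_apply, one_mul,
        mul_one]
      refine Finset.sum_congr rfl fun i _ => Finset.sum_congr rfl fun j _ => ?_
      have : M j i = M i j := by
        conv_lhs => rw [← hMT]
        rfl
      rw [this, ← sq, h01]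
    rw [h1]
    have h4 := (abs_le.1 hq1).2
    nlinarith
  refine ⟨μ i0, hbig, hup i0, fun n hn => ?_⟩
  rw [htr n, ← Finset.add_sum_erase _ _ (Finset.mem_univ i0), add_sub_cancel_left]
  calc |∑ i ∈ Finset.univ.erase i0, μ i ^ n| ≤ ∑ i ∈ Finset.univ.erase i0, |μ i ^ n| :=
        Finset.abs_sum_le_sum_abs _ _
    _ ≤ ∑ i ∈ Finset.univ.erase i0, L ^ (n - 2) * μ i ^ 2 := by
        refine Finset.sum_le_sum fun i hi => ?_
        have h1 : |μ i| ≤ L := abs_le.2 ⟨hlow i, hsmall i (Finset.ne_of_mem_erase hi)⟩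
        obtain ⟨m, rfl⟩ : ∃ m, n = m + 2 := ⟨n - 2, by omega⟩
        rw [abs_pow, pow_add, sq_abs, Nat.add_sub_cancel]
        exact mul_le_mul_of_nonneg_right (pow_le_pow_left₀ (abs_nonneg _) h1 _) (sq_nonneg _)
    _ ≤ ∑ i, L ^ (n - 2) * μ i ^ 2 :=
        Finset.sum_le_sum_of_subset_of_nonneg (Finset.erase_subset _ _)
          fun i _ _ => by positivity
    _ = L ^ (n - 2) * ∑ i, μ i ^ 2 := by rw [Finset.mul_sum]
    _ ≤ _ := mul_le_mul_of_nonneg_left hsq (by positivity)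

end


section WkM
open Finset

theorem wk_pow_path {ι : Type*} [Fintype ι] [DecidableEq ι] (M : Matrix ι ι ℝ) (n : ℕ) :
    ∀ i j, (M ^ (n + 1)) i j = ∑ x : Fin n → ι, ∏ k : Fin (n + 1),
      M ((Fin.cons i x : Fin (n + 1) → ι) k) ((Fin.snoc x j : Fin (n + 1) → ι) k) := by
  induction n with
  | zero =>
    intro i j
    simp [Fin.snoc]
  | succ n ih =>
    intro i j
    rw [pow_succ', Matrix.mul_apply]
    simp_rw [ih]
    rw [← (Fin.consEquiv (fun _ : Fin (n + 1) => ι)).sum_comp, Fintype.sum_prod_type]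
    refine Finset.sum_congr rfl fun a _ => ?_
    rw [Finset.mul_sum]
    refine Finset.sum_congr rfl fun x _ => ?_
    change _ = ∏ k : Fin (n + 1 + 1), M ((Fin.cons i (Fin.cons a x : Fin (n + 1) → ι) : Fin (n + 2) → ι) k)
      ((Fin.snoc (Fin.cons a x : Fin (n + 1) → ι) j : Fin (n + 2) → ι) k)
    rw [Fin.prod_univ_succ (n := n + 1)]
    have h := Fin.cons_snoc_eq_snoc_cons (β := ι) a x j
    rw [← h]
    simp only [Fin.cons_zero, Fin.cons_succ]

theorem wk_trace_path {ι : Type*} [Fintype ι] [DecidableEq ι] (M : Matrix ι ι ℝ) (n : ℕ) :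
    (M ^ (n + 1)).trace = ∑ x : Fin (n + 1) → ι, ∏ k, M (x k) (x (finRotate (n + 1) k)) := by
  rw [← (Fin.consEquiv (fun _ : Fin (n + 1) => ι)).sum_comp, Fintype.sum_prod_type]
  unfold Matrix.trace
  refine Finset.sum_congr rfl fun a _ => ?_
  rw [Matrix.diag_apply, wk_pow_path]
  refine Finset.sum_congr rfl fun x _ => ?_
  refine Finset.prod_congr rfl fun k _ => ?_
  simp only [Fin.consEquiv_apply]
  congr 1
  refine Fin.lastCases ?_ (fun k => ?_) k
  · rw [finRotate_last, Fin.snoc_last, Fin.cons_zero]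
  · rw [finRotate_apply, Fin.coeSucc_eq_succ, Fin.cons_succ, Fin.snoc_castSucc]

open Classical in
theorem wk_trace_card {V : Type*} (E : Finset V) (R : V → V → Prop) (n : ℕ) (hn : 1 ≤ n) :
    (((Matrix.of fun i j : E => if R i j then (1:ℝ) else 0) ^ n).trace) =
      (Nat.card {x : Fin n → V // (∀ i, x i ∈ E) ∧ ∀ i : Fin n, R (x i) (x (finRotate n i))} : ℝ) := by
  obtain ⟨n, rfl⟩ : ∃ m, n = m + 1 := ⟨n - 1, by omega⟩
  rw [wk_trace_path]
  have e : {x : Fin (n+1) → V // (∀ i, x i ∈ E) ∧ ∀ i, R (x i) (x (finRotate (n+1) i))} ≃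
      {x : Fin (n+1) → E // ∀ i, R (x i) (x (finRotate (n+1) i))} :=
    { toFun := fun x => ⟨fun i => ⟨x.1 i, x.2.1 i⟩, x.2.2⟩
      invFun := fun x => ⟨fun i => (x.1 i : V), fun i => (x.1 i).2, x.2⟩
      left_inv := fun x => rfl
      right_inv := fun x => rfl }
  rw [Nat.card_congr e, Nat.card_eq_fintype_card, Fintype.card_subtype]
  simp only [Matrix.of_apply]
  rw [Finset.card_filter]
  push_cast
  refine Finset.sum_congr rfl fun x _ => ?_
  rw [Finset.prod_ite_zero]
  simp

theorem wk_arith (q N x : ℝ) (T μ Λ : ℝ) (n : ℕ) (hn : 6 ≤ n) (hq : 1 ≤ q) (hx : 0 ≤ x)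
    (hΛ : 0 < Λ) (hN : N = q * Λ)
    (h8 : 8 * q * x ^ 2 ≤ 1) (h24 : (24 + 12 * ((n / 2 : ℕ) : ℝ)) * x ≤ 1)
    (h1 : Λ - 2 * x * Λ ≤ μ) (h2 : μ ≤ Λ + 2 * x * Λ)
    (h3 : |T - μ ^ n| ≤ (2 * x * Λ) ^ (n - 2) * (N * (Λ + 2 * x * Λ))) :
    |T - Λ ^ n| ≤ Λ ^ n * (8 * x ^ 2 + (24 + 12 * ((n / 2 : ℕ) : ℝ)) * x) := by
  have hnd : (n : ℝ) ≤ 2 * ((n / 2 : ℕ) : ℝ) + 1 := by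
    have : n ≤ 2 * (n / 2) + 1 := by omega
    exact_mod_cast this
  have hn6 : (6:ℝ) ≤ n := by exact_mod_cast hn
  have hk : (3:ℝ) ≤ ((n / 2 : ℕ) : ℝ) := by
    have : 3 ≤ n / 2 := by omega
    exact_mod_cast this
  have hx60 : x ≤ 1 / 60 := by nlinarith
  have hnx : 6 * n * x ≤ 1 := by nlinarith
  -- first part
  have hA : |T - μ ^ n| ≤ Λ ^ n * (8 * x ^ 2) := by
    refine h3.trans ?_
    have e : (2 * x * Λ) ^ (n - 2) * (N * (Λ + 2 * x * Λ)) =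
        Λ ^ n * ((2 * x) ^ (n - 2) * (q * (1 + 2 * x))) := by
      have : Λ ^ n = Λ ^ (n - 2) * Λ ^ 2 := by rw [← pow_add]; congr 1; omega
      rw [this, mul_pow, hN]; ring
    rw [e]
    refine mul_le_mul_of_nonneg_left ?_ (by positivity)
    have h4 : (2 * x) ^ (n - 2) ≤ (2 * x) ^ 4 :=
      pow_le_pow_of_le_one (by linarith) (by linarith) (by omega)
    calc (2 * x) ^ (n - 2) * (q * (1 + 2 * x)) ≤ (2 * x) ^ 4 * (q * (1 + 2 * x)) := by gcongr
      _ = (8 * q * x ^ 2) * (2 * x ^ 2 * (1 + 2 * x)) := by ring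
      _ ≤ 1 * (2 * x ^ 2 * (1 + 2 * x)) := by gcongr
      _ ≤ 8 * x ^ 2 := by nlinarith [sq_nonneg x]
  set s := μ / Λ with hs
  have hμ : μ = s * Λ := by rw [hs]; field_simp
  have hs1 : 1 - 2 * x ≤ s := by rw [hs, le_div_iff₀ hΛ]; linarith
  have hs2 : s ≤ 1 + 2 * x := by rw [hs, div_le_iff₀ hΛ]; linarith
  have hup : s ^ n ≤ 1 + 6 * n * x := by
    have hb : 1 - n * (2 * x) ≤ (1 - 2 * x) ^ n := by
      have := one_add_mul_le_pow (a := -(2 * x)) (by linarith) n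
      calc _ = 1 + (n:ℝ) * (-(2 * x)) := by ring
        _ ≤ _ := this
        _ = _ := by ring
    have hb2 : (1 + 2 * x) ^ n * (1 - 2 * x) ^ n ≤ 1 := by
      rw [← mul_pow]
      exact pow_le_one₀ (by nlinarith) (by nlinarith)
    have h0 : s ^ n ≤ (1 + 2 * x) ^ n := pow_le_pow_left₀ (by linarith) hs2 n
    have h5 : (1 + 2 * x) ^ n * (1 - n * (2 * x)) ≤ 1 :=
      (mul_le_mul_of_nonneg_left hb (by positivity)).trans hb2
    refine h0.trans ?_
    have h6 : 1 ≤ (1 + 6 * n * x) * (1 - n * (2 * x)) := by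
      have : 0 ≤ n * x := by positivity
      nlinarith
    have h7 : 0 < 1 - n * (2 * x) := by nlinarith
    exact le_of_mul_le_mul_right (h5.trans h6) h7
  have hlo : 1 - 6 * n * x ≤ s ^ n := by
    have hb := one_add_mul_le_pow (a := -(2 * x)) (by linarith) n
    have h0 : (1 + -(2 * x)) ^ n ≤ s ^ n := pow_le_pow_left₀ (by linarith) (by linarith) n
    have : 0 ≤ n * x := by positivity
    linarith
  have hB : |μ ^ n - Λ ^ n| ≤ Λ ^ n * ((24 + 12 * ((n / 2 : ℕ) : ℝ)) * x) := by
    have e : μ ^ n - Λ ^ n = Λ ^ n * (s ^ n - 1) := by rw [hμ, mul_pow]; ring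
    rw [e, abs_mul, abs_of_nonneg (by positivity : 0 ≤ Λ ^ n)]
    refine mul_le_mul_of_nonneg_left ?_ (by positivity)
    have : 6 * n * x ≤ (24 + 12 * ((n / 2 : ℕ) : ℝ)) * x := by nlinarith
    rw [abs_le]; constructor <;> linarith
  calc |T - Λ ^ n| = |(T - μ ^ n) + (μ ^ n - Λ ^ n)| := by congr 1; ring
    _ ≤ _ := abs_add_le _ _
    _ ≤ _ := add_le_add hA hB
    _ = _ := by ring

open Classical in
theorem wk_form_E {F : Type*} [Field F] [Fintype F] (d : ℕ) (hodd : Odd (Fintype.card F))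
    (Q : QuadraticForm F (Fin d → F))
    (hQ : ∀ x, (∀ y, QuadraticMap.polar (⇑Q) x y = 0) → x = 0) (t : F) (ht : t ≠ 0)
    (E : Finset (Fin d → F)) (f : E → ℝ) :
    |f ⬝ᵥ ((Matrix.of fun i j : E => if Q ((i : Fin d → F) - j) = t then (1:ℝ) else 0).mulVec f)
      - 1 / (Fintype.card F : ℝ) * (∑ i, f i) ^ 2| ≤
    (1 / (Fintype.card F:ℝ)) * (√(Fintype.card F:ℝ) ^ d * (2 * √(Fintype.card F:ℝ))) * (f ⬝ᵥ f) := by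
  have key := wk_form_bound d hodd Q hQ t ht (fun x => if h : x ∈ E then f ⟨x, h⟩ else 0)
  have hsum : ∀ g : (Fin d → F) → ℝ, (∀ x, x ∉ E → g x = 0) → ∑ x, g x = ∑ x : E, g x := by
    intro g hg
    rw [Finset.sum_coe_sort E g]
    exact (Finset.sum_subset (Finset.subset_univ E) (fun x _ hx => hg x hx)).symm
  rw [hsum (fun x => (if h : x ∈ E then f ⟨x, h⟩ else 0) ^ 2) (by intro x hx; simp [hx]),
    hsum _ (by intro x hx; simp [hx])] at key
  have e2 : ∀ x : E, ∑ y, (if h : (x : Fin d → F) ∈ E then f ⟨x, h⟩ else 0) *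
      (if h : y ∈ E then f ⟨y, h⟩ else 0) * ((if Q ((x : Fin d → F) - y) = t then (1:ℝ) else 0) - 1 / (Fintype.card F : ℝ))
      = ∑ y : E, f x * f y * ((if Q ((x : Fin d → F) - y) = t then (1:ℝ) else 0) - 1 / (Fintype.card F : ℝ)) := by
    intro x
    rw [hsum _ (by intro y hy; simp [hy])]
    refine Finset.sum_congr rfl fun y _ => ?_
    simp
  rw [Finset.sum_congr rfl fun x _ => e2 x] at key
  have e3 : ∑ x : E, (if h : (x : Fin d → F) ∈ E then f ⟨x, h⟩ else 0) ^ 2 = f ⬝ᵥ f := by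
    refine Finset.sum_congr rfl fun y _ => ?_
    simp [sq]
  rw [e3] at key
  refine le_trans (le_of_eq ?_) key
  congr 1
  simp only [dotProduct, Matrix.mulVec, Matrix.of_apply, mul_sub, Finset.sum_sub_distrib, Finset.mul_sum]
  congr 1
  · refine Finset.sum_congr rfl fun x _ => Finset.sum_congr rfl fun y _ => ?_
    ring
  · rw [sq, Finset.sum_mul_sum, Finset.mul_sum]
    refine Finset.sum_congr rfl fun x _ => ?_
    rw [Finset.mul_sum]
    refine Finset.sum_congr rfl fun y _ => ?_
    ring

open Classical in
theorem wk_main (q d n : ℕ) (hn : 6 ≤ n)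
    (F : Type) [Field F] [Fintype F]
    (hq : Fintype.card F = q) (hodd : Odd q)
    (Q : QuadraticForm F (Fin d → F))
    (hQ : ∀ x, (∀ y, QuadraticMap.polar (⇑Q) x y = 0) → x = 0)
    (t : F) (ht : t ≠ 0)
    (E : Finset (Fin d → F)) (hE : E.Nonempty)
    (γ : ℝ)
    (hsize : 12 * (q : ℝ) ^ γ + 8 * (q : ℝ) ^ (d + 2) / (E.card : ℝ) ^ 2 +
        (24 + 12 * ((n / 2 : ℕ) : ℝ)) * (q : ℝ) ^ (((d : ℝ) + 1) / 2) / (E.card : ℝ) ≤ 1) :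
    |(Nat.card {x : Fin n → (Fin d → F) // (∀ i, x i ∈ E) ∧
        ∀ i : Fin n, Q (x i - x (finRotate n i)) = t} : ℝ) -
        (E.card : ℝ) ^ n / (q : ℝ) ^ n| ≤
      ((E.card : ℝ) ^ n / (q : ℝ) ^ n) *
        (12 * (q : ℝ) ^ γ + 8 * (q : ℝ) ^ (d + 1) / (E.card : ℝ) ^ 2 +
          (24 + 12 * ((n / 2 : ℕ) : ℝ)) * (q : ℝ) ^ (((d : ℝ) + 1) / 2) / (E.card : ℝ)) := by
  subst hq
  set q := Fintype.card F with hqdef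
  have hq1 : (1:ℝ) ≤ q := by
    have : 0 < q := Fintype.card_pos
    exact_mod_cast this
  have hq0 : (0:ℝ) < q := by linarith
  have hN : (0:ℝ) < E.card := by exact_mod_cast hE.card_pos
  have hrp : (q : ℝ) ^ (((d : ℝ) + 1) / 2) = √(q:ℝ) ^ (d + 1) := by
    rw [Real.sqrt_eq_rpow, ← Real.rpow_natCast, ← Real.rpow_mul hq0.le]
    congr 1; push_cast; ring
  have hss : (√(q:ℝ) ^ (d + 1)) ^ 2 = (q:ℝ) ^ (d + 1) := by
    rw [← pow_mul, mul_comm, pow_mul, Real.sq_sqrt hq0.le]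
  rw [hrp] at hsize ⊢
  set x : ℝ := √(q:ℝ) ^ (d + 1) / E.card with hx
  have hx0 : 0 ≤ x := by positivity
  have e1 : 8 * (q : ℝ) ^ (d + 1) / (E.card : ℝ) ^ 2 = 8 * x ^ 2 := by
    rw [hx, div_pow, hss]; ring
  have e2 : 8 * (q : ℝ) ^ (d + 2) / (E.card : ℝ) ^ 2 = 8 * q * x ^ 2 := by
    rw [hx, div_pow, hss]; ring
  have e3 : (24 + 12 * ((n / 2 : ℕ) : ℝ)) * √(q:ℝ) ^ (d + 1) / (E.card : ℝ) =
      (24 + 12 * ((n / 2 : ℕ) : ℝ)) * x := by rw [hx]; ring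
  rw [e2, e3] at hsize
  rw [e1, e3, ← div_pow]
  have hg : 0 ≤ 12 * (q:ℝ) ^ γ := by positivity
  have p1 : 0 ≤ 8 * q * x ^ 2 := by positivity
  have p2 : 0 ≤ (24 + 12 * ((n / 2 : ℕ) : ℝ)) * x := by positivity
  have : Nonempty E := hE.to_subtype
  have hL : (1 / (q:ℝ)) * (√(q:ℝ) ^ d * (2 * √(q:ℝ))) = 2 * x * (E.card / q) := by
    rw [hx, pow_succ]; field_simp
  obtain ⟨μ, h1, h2, h3⟩ := wk_spec
    (Matrix.of fun i j : E => if Q ((i : Fin d → F) - j) = t then (1:ℝ) else 0)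
    (by
      ext i j
      have : Q ((i : Fin d → F) - j) = Q ((j : Fin d → F) - i) := by
        rw [← neg_sub, QuadraticMap.map_neg]
      simp [Matrix.conjTranspose_apply, this])
    (by intro i j; simp only [Matrix.of_apply]; split_ifs <;> norm_num)
    (1 / (q:ℝ)) ((1 / (q:ℝ)) * (√(q:ℝ) ^ d * (2 * √(q:ℝ)))) (by positivity) (by positivity)
    (wk_form_E d hodd Q hQ t ht E)
  have h3 := h3 n (by omega)
  have htr : ((Matrix.of fun i j : E => if Q ((i : Fin d → F) - j) = t then (1:ℝ) else 0) ^ n).trace =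
      (Nat.card {x : Fin n → (Fin d → F) // (∀ i, x i ∈ E) ∧
        ∀ i : Fin n, Q (x i - x (finRotate n i)) = t} : ℝ) := by
    convert wk_trace_card E (fun a b => Q (a - b) = t) n (by omega)
  rw [htr] at h3
  rw [hL, Fintype.card_coe] at h1 h2 h3
  have e4 : 1 / (q:ℝ) * E.card = E.card / q := by ring
  rw [e4] at h1 h2 h3
  have := wk_arith q E.card x _ μ (E.card / q) n hn hq1 hx0 (by positivity) (by field_simp)
    (by linarith) (by linarith) h1 h2 h3
  refine this.trans (mul_le_mul_of_nonneg_left (by linarith) (by positivity))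

end WkM


open Finset

/-- Counting `n`-cycles (`n ≥ 6`) with all edge lengths equal to `t`,
for the distance `φ(x,y) = Q(x-y)` coming from a non-degenerate quadratic form.
Here `finRotate n i = i + 1` cyclically, so the constraint is
`φ(x_i, x_{i+1}) = t` for `1 ≤ i ≤ n-1` together with `φ(x_n, x_1) = t`. -/
theorem stmt11 (q d n : ℕ) (hd : 2 ≤ d) (hn : 6 ≤ n)
    (F : Type) [Field F] [Fintype F]
    (hq : Fintype.card F = q) (hodd : Odd q)
    (Q : QuadraticForm F (Fin d → F))
    (hQ : ∀ x, (∀ y, QuadraticMap.polar (⇑Q) x y = 0) → x = 0)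
    (t : F) (ht : t ≠ 0)
    (E : Finset (Fin d → F))
    (γ : ℝ) (hγ : γ = if d = 2 then -1 else -(((d : ℝ) - 2) / 2))
    (hsize : 12 * (q : ℝ) ^ γ + 8 * (q : ℝ) ^ (d + 2) / (E.card : ℝ) ^ 2 +
        (24 + 12 * ((n / 2 : ℕ) : ℝ)) * (q : ℝ) ^ (((d : ℝ) + 1) / 2) / (E.card : ℝ) ≤ 1) :
    |(Nat.card {x : Fin n → (Fin d → F) // (∀ i, x i ∈ E) ∧
        ∀ i : Fin n, Q (x i - x (finRotate n i)) = t} : ℝ) -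
        (E.card : ℝ) ^ n / (q : ℝ) ^ n| ≤
      ((E.card : ℝ) ^ n / (q : ℝ) ^ n) *
        (12 * (q : ℝ) ^ γ + 8 * (q : ℝ) ^ (d + 1) / (E.card : ℝ) ^ 2 +
          (24 + 12 * ((n / 2 : ℕ) : ℝ)) * (q : ℝ) ^ (((d : ℝ) + 1) / 2) / (E.card : ℝ)) := by
  rcases E.eq_empty_or_nonempty with hE | hE
  · subst hE
    have h0 : n ≠ 0 := by omega
    have : IsEmpty {x : Fin n → (Fin d → F) // (∀ i, x i ∈ (∅ : Finset (Fin d → F))) ∧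
        ∀ i : Fin n, Q (x i - x (finRotate n i)) = t} :=
      ⟨fun x => absurd (x.2.1 ⟨0, by omega⟩) (Finset.notMem_empty _)⟩
    rw [Nat.card_of_isEmpty]
    simp [h0]
  · exact wk_main q d n hn F hq hodd Q hQ t ht E hE γ hsize
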